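/- arXiv:math/0608364 — 3 statements merged into one kernel-verified Lean document; each statement's English description precedes it below -/
import Mathlib

section
/- Let Γ be a countable discrete group with Kazhdan's property (T), let Γ₀ ≤ Γ be a subgroup of infinite index, let (X₀,μ₀) be an arbitrary probability space, and let Γ act on the product probability space (X,μ) = (∏_{c ∈ Γ/Γ₀} X₀, ⊗_{c ∈ Γ/Γ₀} μ₀) by the generalized Bernoulli action (g·x)_c = x_{g⁻¹c}. Then for every countable discrete group Λ and every measurable cocycle α : Γ × X → Λ there exist a group homomorphism ρ : Γ → Λ and a measurable map φ : X → Λ such that for every g ∈ Γ, α(g,x) = φ(g·x)·ρ(g)·φ(x)⁻¹ for μ-a.e. x ∈ X. -/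
open MeasureTheory

/-- A countable discrete group `Γ` has Kazhdan's property (T): every unitary
representation of `Γ` on a complex separable Hilbert space that almost has
invariant vectors has a nonzero invariant vector. -/
def HasPropertyT (Γ : Type) [Group Γ] : Prop :=
  ∀ (V : Type) [NormedAddCommGroup V] [InnerProductSpace ℂ V] [CompleteSpace V]
    [TopologicalSpace.SeparableSpace V] (π : Γ →* (V ≃ₗᵢ[ℂ] V)),
    (∀ (F : Finset Γ) (ε : ℝ), 0 < ε → ∃ v : V, ‖v‖ = 1 ∧ ∀ g ∈ F, ‖π g v - v‖ < ε) →
    ∃ v : V, v ≠ 0 ∧ ∀ g : Γ, π g v = v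

section Kazhdan

variable {Γ : Type} [Group Γ]

/-- A family of linear isometries indexed by a group and compatible with the group law, bundled
as a unitary representation. -/
noncomputable def unitaryRep {V : Type} [NormedAddCommGroup V] [InnerProductSpace ℂ V]
    (π : Γ → V →ₗᵢ[ℂ] V) (h1 : ∀ v, π 1 v = v) (hmul : ∀ g h v, π (g * h) v = π g (π h v)) :
    Γ →* (V ≃ₗᵢ[ℂ] V) where
  toFun g := LinearIsometryEquiv.ofSurjective (π g)
    (fun v => ⟨π g⁻¹ v, by rw [← hmul, mul_inv_cancel, h1]⟩)
  map_one' := LinearIsometryEquiv.ext h1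
  map_mul' g h := LinearIsometryEquiv.ext (hmul g h)

/-- Property (T) for representations on possibly non-separable Hilbert spaces: if almost invariant
vectors can be found in a countable set, then there is a nonzero invariant vector in the closed
invariant subspace this set generates. -/
lemma HasPropertyT.exists_invariant_mem_closure [Countable Γ] (hT : HasPropertyT Γ)
    {V : Type} [NormedAddCommGroup V] [InnerProductSpace ℂ V] [CompleteSpace V]
    (π : Γ → V →ₗᵢ[ℂ] V) (h1 : ∀ v, π 1 v = v) (hmul : ∀ g h v, π (g * h) v = π g (π h v))
    (u : ℕ → V) {δ : ℝ} (hδ : 0 < δ) (hu : ∀ n, δ ≤ ‖u n‖)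
    (hinv : ∀ (F : Finset Γ) (ε : ℝ), 0 < ε → ∃ n, ∀ g ∈ F, ‖π g (u n) - u n‖ < ε) :
    ∃ w ∈ (Submodule.span ℂ (Set.range fun p : Γ × ℕ => π p.1 (u p.2))).topologicalClosure,
      w ≠ 0 ∧ ∀ g, π g w = w := by
  set S := Submodule.span ℂ (Set.range fun p : Γ × ℕ => π p.1 (u p.2)) with hS
  set K := S.topologicalClosure with hKdef
  have hSK : ∀ g v, v ∈ S → π g v ∈ S := by
    intro g v hv
    have : S ≤ S.comap (π g).toLinearMap := by
      rw [hS, Submodule.span_le]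
      rintro _ ⟨p, rfl⟩
      refine Submodule.subset_span ⟨(g * p.1, p.2), ?_⟩
      simp [hmul]
    exact this hv
  have hK : ∀ g, ∀ v ∈ K, π g v ∈ K := by
    intro g v hv
    have : K ≤ K.comap (π g).toLinearMap := by
      refine Submodule.topologicalClosure_minimal _ ?_ ?_
      · intro v hv
        exact S.le_topologicalClosure (hSK g v hv)
      · exact S.isClosed_topologicalClosure.preimage (π g).continuous
    exact this hv
  have hsep : TopologicalSpace.SeparableSpace K := by
    have : TopologicalSpace.IsSeparable (K : Set V) := by
      rw [hKdef, Submodule.topologicalClosure_coe]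
      exact ((Set.countable_range _).isSeparable.span).closure
    exact this.separableSpace
  have hcomplete : CompleteSpace K := S.isClosed_topologicalClosure.completeSpace_coe
  let ρ : Γ → K →ₗᵢ[ℂ] K := fun g => ⟨(π g).toLinearMap.restrict (hK g), fun v => (π g).norm_map v⟩
  have hρ : ∀ g (v : K), (ρ g v : V) = π g v := fun g v => rfl
  obtain ⟨w, hw0, hw⟩ := hT K (unitaryRep ρ (fun v => Subtype.ext (h1 v))
    (fun g h v => Subtype.ext (hmul g h v))) (by
      intro F ε hε
      obtain ⟨n, hn⟩ := hinv F (ε * δ) (by positivity)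
      have hpos : 0 < ‖u n‖ := hδ.trans_le (hu n)
      have hmem : u n ∈ K := S.le_topologicalClosure
        (Submodule.subset_span ⟨(1, n), by simp [h1]⟩)
      refine ⟨((‖u n‖⁻¹ : ℝ) : ℂ) • ⟨u n, hmem⟩, ?_, ?_⟩
      · rw [norm_smul]
        simp [hpos.ne']
      · intro g hg
        rw [map_smul, ← smul_sub, norm_smul]
        have h2 : ‖(unitaryRep ρ (fun v => Subtype.ext (h1 v))
            (fun g h v => Subtype.ext (hmul g h v)) g) ⟨u n, hmem⟩ - (⟨u n, hmem⟩ : K)‖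
            = ‖π g (u n) - u n‖ := rfl
        rw [h2]
        have h3 : ‖((‖u n‖⁻¹ : ℝ) : ℂ)‖ = ‖u n‖⁻¹ := by simp
        rw [h3, inv_mul_lt_iff₀ hpos]
        calc _ < ε * δ := hn g hg
          _ ≤ ε * ‖u n‖ := by gcongr; exact hu n
          _ = _ := mul_comm _ _)
  refine ⟨w, w.2, fun h => hw0 (Subtype.ext h), fun g => ?_⟩
  exact congrArg Subtype.val (hw g)

/-- The `ℓ²`-direct sum of isometries. -/
noncomputable def lpIsometry {V : ℕ → Type} [∀ n, NormedAddCommGroup (V n)]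
    [∀ n, InnerProductSpace ℂ (V n)] (T : ∀ n, V n →ₗᵢ[ℂ] V n) : lp V 2 →ₗᵢ[ℂ] lp V 2 where
  toFun f := ⟨fun n => T n (f n), by
    have := lp.memℓp f
    rw [memℓp_gen_iff (by norm_num)] at this
    refine (memℓp_gen_iff (by norm_num)).2 ?_
    simpa using this⟩
  map_add' f g := by ext n; exact map_add (T n) (f n) (g n)
  map_smul' c f := by ext n; simp
  norm_map' f := by
    simp [lp.norm_eq_tsum_rpow (p := 2) (by norm_num)]

lemma lpIsometry_apply {V : ℕ → Type} [∀ n, NormedAddCommGroup (V n)]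
    [∀ n, InnerProductSpace ℂ (V n)] (T : ∀ n, V n →ₗᵢ[ℂ] V n) (f : lp V 2) (n : ℕ) :
    lpIsometry T f n = T n (f n) := rfl

lemma lpIsometry_single {V : ℕ → Type} [∀ n, NormedAddCommGroup (V n)]
    [∀ n, InnerProductSpace ℂ (V n)] (T : ∀ n, V n →ₗᵢ[ℂ] V n) (n : ℕ) (v : V n) :
    lpIsometry T (lp.single 2 n v) = lp.single 2 n (T n v) := by
  ext m
  rw [lpIsometry_apply, lp.single_apply, lp.single_apply]
  by_cases h : m = n
  · subst h; simp
  · simp [h]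

/-- Every vector is the sum of an invariant vector and a vector orthogonal to all invariant
vectors. -/
lemma exists_sub_invariant_orthogonal {ι V : Type} [NormedAddCommGroup V] [InnerProductSpace ℂ V]
    [CompleteSpace V] (π : ι → V →ₗᵢ[ℂ] V) (v : V) :
    ∃ p : V, (∀ g, π g p = p) ∧ ∀ w, (∀ g, π g w = w) → inner ℂ w (v - p) = 0 := by
  let W : Submodule ℂ V := ⨅ g, LinearMap.eqLocus (π g).toLinearMap LinearMap.id
  have hW : ∀ w, w ∈ W ↔ ∀ g, π g w = w := by
    intro w; simp [W, Submodule.mem_iInf, LinearMap.mem_eqLocus]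
  have hclosed : IsClosed (W : Set V) := by
    have : (W : Set V) = ⋂ g, {w | π g w = w} := by
      ext w; simp [hW]
    rw [this]
    exact isClosed_iInter fun g => isClosed_eq (π g).continuous continuous_id
  have : CompleteSpace W := hclosed.completeSpace_coe
  refine ⟨W.starProjection v, ?_, ?_⟩
  · exact (hW _).1 (Submodule.starProjection_apply_mem W v)
  · intro w hw
    have := Submodule.sub_starProjection_mem_orthogonal (K := W) v
    exact (Submodule.mem_orthogonal _ _).1 this w ((hW w).2 hw)

/-- The quantitative form of property (T): vectors that are sufficiently invariant under a finite
set are close to invariant vectors, uniformly over all representations. -/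
theorem HasPropertyT.exists_kazhdan_pair [Countable Γ] (hT : HasPropertyT Γ) {δ : ℝ}
    (hδ : 0 < δ) : ∃ (F : Finset Γ) (ε : ℝ), 0 < ε ∧
      ∀ (V : Type) [NormedAddCommGroup V] [InnerProductSpace ℂ V] [CompleteSpace V]
        (π : Γ → V →ₗᵢ[ℂ] V) (_ : ∀ v, π 1 v = v) (_ : ∀ g h v, π (g * h) v = π g (π h v))
        (v : V), (∀ g ∈ F, ‖π g v - v‖ < ε) → ∃ w, (∀ g, π g w = w) ∧ ‖v - w‖ < δ := by
  classical
  by_contra! hcon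
  obtain ⟨e, he⟩ := exists_surjective_nat Γ
  choose V i₁ i₂ i₃ π h1 hmul v hv hfar using fun n : ℕ =>
    hcon ((Finset.range n).image e) (1 / ((n : ℝ) + 1)) (by positivity)
  choose p hp horth using fun n => exists_sub_invariant_orthogonal (π n) (v n)
  obtain ⟨w, hwK, hw0, hw⟩ := hT.exists_invariant_mem_closure (V := lp V 2)
    (fun g => lpIsometry fun n => π n g)
    (fun f => by ext n; simp [lpIsometry_apply, h1])
    (fun g h f => by ext n; simp [lpIsometry_apply, hmul])
    (fun n => lp.single 2 n (v n - p n)) hδ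
    (fun n => by rw [lp.norm_single (by norm_num)]; exact hfar n (p n) (hp n))
    (by
      intro F ε hε
      choose N hN using he
      obtain ⟨M, hM⟩ := exists_nat_one_div_lt hε
      refine ⟨max M (F.sup N + 1), fun g hg => ?_⟩
      rw [lpIsometry_single, ← lp.single_sub, lp.norm_single (by norm_num), map_sub, hp,
        sub_sub_sub_cancel_right]
      refine (hv _ g ?_).trans_le (le_trans ?_ hM.le)
      · refine Finset.mem_image.2 ⟨N g, ?_, hN g⟩
        have : N g ≤ F.sup N := Finset.le_sup hg
        simp; omega
      · gcongr
        exact le_max_left _ _)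
  refine hw0 ?_
  ext n
  have hwn : ∀ g, π n g (w n) = w n := fun g => by
    have := hw g
    rw [← lpIsometry_apply (fun n => π n g), this]
  have hker : Submodule.span ℂ (Set.range fun q : Γ × ℕ =>
      lpIsometry (fun n => π n q.1) (lp.single 2 q.2 (v q.2 - p q.2))) ≤
      LinearMap.ker (innerSL ℂ (lp.single 2 n (w n) : lp V 2)).toLinearMap := by
    rw [Submodule.span_le]
    rintro _ ⟨⟨g, m⟩, rfl⟩
    simp only [SetLike.mem_coe, LinearMap.mem_ker, ContinuousLinearMap.coe_coe, innerSL_apply_apply]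
    rw [lp.inner_single_left, lpIsometry_apply, lp.single_apply]
    by_cases h : n = m
    · subst h
      simp only [Pi.single_eq_same]
      rw [← hwn g, LinearIsometry.inner_map_map]
      exact horth n _ hwn
    · simp [h]
  have hz := Submodule.topologicalClosure_minimal _ hker
    (ContinuousLinearMap.isClosed_ker _) hwK
  simp only [LinearMap.mem_ker, ContinuousLinearMap.coe_coe, innerSL_apply_apply] at hz
  rw [lp.inner_single_left] at hz
  simpa using hz

end Kazhdan

section Coupling

open Filter Topology

variable {ι X Y : Type*} [MeasurableSpace X] [MeasurableSpace Y]

/-- Setwise convergence of uniformly dominated measures can be tested on a `π`-system. -/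
lemma tendsto_measureReal_of_isPiSystem {l : Filter ι} {ν : ι → Measure X} {ν' μ : Measure X}
    [IsFiniteMeasure μ] (hle : ∀ i, ν i ≤ μ) (hle' : ν' ≤ μ) {S : Set (Set X)}
    (hS : IsPiSystem S) (hgen : MeasurableSpace.generateFrom S = ‹MeasurableSpace X›)
    (huniv : Tendsto (fun i => (ν i).real Set.univ) l (𝓝 (ν'.real Set.univ)))
    (hlim : ∀ A ∈ S, Tendsto (fun i => (ν i).real A) l (𝓝 (ν'.real A)))
    {A : Set X} (hA : MeasurableSet A) :
    Tendsto (fun i => (ν i).real A) l (𝓝 (ν'.real A)) := by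
  have hfin : ∀ i, IsFiniteMeasure (ν i) := fun i => isFiniteMeasure_of_le μ (hle i)
  have hfin' : IsFiniteMeasure ν' := isFiniteMeasure_of_le μ hle'
  induction A, hA using MeasurableSpace.induction_on_inter hgen.symm hS with
  | empty => simpa using tendsto_const_nhds
  | basic A hA => exact hlim A hA
  | compl A hA ih =>
    simp only [measureReal_compl hA]
    exact huniv.sub ih
  | iUnion f hd hf ih =>
    have key : ∀ (ρ : Measure X) [IsFiniteMeasure ρ],
        HasSum (fun n => ρ.real (f n)) (ρ.real (⋃ n, f n)) := by
      intro ρ _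
      have h := measure_iUnion (μ := ρ) hd hf
      have hne : ∀ n, ρ (f n) ≠ ⊤ := fun n => measure_ne_top ρ _
      have hsum : ∑' n, ρ (f n) ≠ ⊤ := by rw [← h]; exact measure_ne_top ρ _
      have := ENNReal.hasSum_toReal hsum
      rwa [← ENNReal.tsum_toReal_eq hne, ← h] at this
    simp only [← fun i => (key (ν i)).tsum_eq, ← (key ν').tsum_eq]
    refine tendsto_tsum_of_dominated_convergence (bound := fun n => μ.real (f n))
      (key μ).summable ih (Eventually.of_forall fun i n => ?_)
    rw [Real.norm_of_nonneg measureReal_nonneg]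
    exact ENNReal.toReal_mono (measure_ne_top μ _) (hle i _)

/-- Convergence of couplings of two fixed probability measures can be tested on products of sets
from generating `π`-systems. -/
lemma tendsto_coupling_of_isPiSystem {l : Filter ι} {J : ι → Measure (X × Y)}
    {J' : Measure (X × Y)} {μ : Measure X} {ν : Measure Y} [IsFiniteMeasure μ] [IsFiniteMeasure ν]
    (hfst : ∀ i, (J i).fst = μ) (hsnd : ∀ i, (J i).snd = ν) (hfst' : J'.fst = μ)
    (hsnd' : J'.snd = ν) {S : Set (Set X)} {T : Set (Set Y)}
    (hS : IsPiSystem S) (hSgen : MeasurableSpace.generateFrom S = ‹MeasurableSpace X›)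
    (hT : IsPiSystem T) (hTgen : MeasurableSpace.generateFrom T = ‹MeasurableSpace Y›)
    (hlim : ∀ A ∈ S, ∀ B ∈ T, Tendsto (fun i => (J i).real (A ×ˢ B)) l (𝓝 (J'.real (A ×ˢ B))))
    {A : Set X} {B : Set Y} (hA : MeasurableSet A) (hB : MeasurableSet B) :
    Tendsto (fun i => (J i).real (A ×ˢ B)) l (𝓝 (J'.real (A ×ˢ B))) := by
  have hSm : ∀ A ∈ S, MeasurableSet A := fun A hA => by
    rw [← hSgen]; exact MeasurableSpace.measurableSet_generateFrom hA
  -- for fixed `B`, the measure `A ↦ ρ (A ×ˢ B)`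
  have e1 : ∀ (ρ : Measure (X × Y)) {A B}, MeasurableSet A → MeasurableSet B →
      ((ρ.restrict (Set.univ ×ˢ B)).fst).real A = ρ.real (A ×ˢ B) := by
    intro ρ A B hA hB
    rw [measureReal_def, measureReal_def, Measure.fst_apply hA,
      Measure.restrict_apply (measurable_fst hA)]
    congr 2; ext; simp
  have e2 : ∀ (ρ : Measure (X × Y)) {A B}, MeasurableSet A → MeasurableSet B →
      ((ρ.restrict (A ×ˢ Set.univ)).snd).real B = ρ.real (A ×ˢ B) := by
    intro ρ A B hA hB
    rw [measureReal_def, measureReal_def, Measure.snd_apply hB,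
      Measure.restrict_apply (measurable_snd hB)]
    congr 2; ext; simp [and_comm]
  have l1 : ∀ (ρ : Measure (X × Y)) (B : Set Y), (ρ.restrict (Set.univ ×ˢ B)).fst ≤ ρ.fst :=
    fun ρ B => Measure.map_mono Measure.restrict_le_self measurable_fst
  have l2 : ∀ (ρ : Measure (X × Y)) (A : Set X), (ρ.restrict (A ×ˢ Set.univ)).snd ≤ ρ.snd :=
    fun ρ A => Measure.map_mono Measure.restrict_le_self measurable_snd
  have u1 : ∀ (ρ : Measure (X × Y)) {A}, MeasurableSet A → ρ.real (A ×ˢ Set.univ) = ρ.fst.real A :=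
    fun ρ A hA => by
      rw [measureReal_def, measureReal_def, Measure.fst_apply hA]; congr 2; ext; simp
  have u2 : ∀ (ρ : Measure (X × Y)) {B}, MeasurableSet B → ρ.real (Set.univ ×ˢ B) = ρ.snd.real B :=
    fun ρ B hB => by
      rw [measureReal_def, measureReal_def, Measure.snd_apply hB]; congr 2; ext; simp
  have step : ∀ A ∈ S, ∀ B, MeasurableSet B →
      Tendsto (fun i => (J i).real (A ×ˢ B)) l (𝓝 (J'.real (A ×ˢ B))) := by
    intro A hA B hB
    have := tendsto_measureReal_of_isPiSystem (l := l) (μ := ν)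
      (ν := fun i => ((J i).restrict (A ×ˢ Set.univ)).snd) (ν' := (J'.restrict (A ×ˢ Set.univ)).snd)
      (fun i => (l2 _ _).trans_eq (hsnd i)) ((l2 _ _).trans_eq hsnd') hT hTgen
      (by simp [e2 _ (hSm A hA) MeasurableSet.univ, u1 _ (hSm A hA), hfst, hfst', tendsto_const_nhds])
      (fun B hB => by
        have hBm : MeasurableSet B := by
          rw [← hTgen]; exact MeasurableSpace.measurableSet_generateFrom hB
        simpa only [e2 _ (hSm A hA) hBm] using hlim A hA B hB) hB
    simpa only [e2 _ (hSm A hA) hB] using this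
  have := tendsto_measureReal_of_isPiSystem (l := l) (μ := μ)
      (ν := fun i => ((J i).restrict (Set.univ ×ˢ B)).fst) (ν' := (J'.restrict (Set.univ ×ˢ B)).fst)
      (fun i => (l1 _ _).trans_eq (hfst i)) ((l1 _ _).trans_eq hfst') hS hSgen
      (by simp [e1 _ MeasurableSet.univ hB, u2 _ hB, hsnd, hsnd', tendsto_const_nhds])
      (fun A hA => by simpa only [e1 _ (hSm A hA) hB] using step A hA B hB) hA
  simpa only [e1 _ hA hB] using this

end Coupling

section Mixing

open Filter Topology

variable {Γ : Type*} [Group Γ] {X Y : Type*} [MeasurableSpace X] [MeasurableSpace Y]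
  [MulAction Γ X] [MulAction Γ Y]

instance [MeasurableConstSMul Γ X] [MeasurableConstSMul Γ Y] : MeasurableConstSMul Γ (X × Y) :=
  ⟨fun g => ((measurable_const_smul g).comp measurable_fst).prodMk
    ((measurable_const_smul g).comp measurable_snd)⟩

instance [MeasurableConstSMul Γ X] [MeasurableConstSMul Γ Y] {μ : Measure X} {ν : Measure Y}
    [SFinite μ] [SFinite ν] [SMulInvariantMeasure Γ X μ] [SMulInvariantMeasure Γ Y ν] :
    SMulInvariantMeasure Γ (X × Y) (μ.prod ν) :=
  ⟨fun g _ hs => ((measurePreserving_smul g μ).prod (measurePreserving_smul g ν)).measure_preimage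
    hs.nullMeasurableSet⟩

/-- The action of `Γ` on `(X, μ)` is mixing along the filter `l`. -/
def MixingAlong (l : Filter Γ) (μ : Measure X) : Prop :=
  ∀ A B : Set X, MeasurableSet A → MeasurableSet B →
    Tendsto (fun g : Γ => μ.real ((g • ·) ⁻¹' A ∩ B)) l (𝓝 (μ.real A * μ.real B))

lemma mixingAlong_of_isPiSystem [MeasurableConstSMul Γ X] {l : Filter Γ} {μ : Measure X}
    [IsProbabilityMeasure μ] [SMulInvariantMeasure Γ X μ] {S : Set (Set X)}
    (hS : IsPiSystem S) (hgen : MeasurableSpace.generateFrom S = ‹MeasurableSpace X›)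
    (h : ∀ A ∈ S, ∀ B ∈ S,
      Tendsto (fun g : Γ => μ.real ((g • ·) ⁻¹' A ∩ B)) l (𝓝 (μ.real A * μ.real B))) :
    MixingAlong l μ := by
  intro A B hA hB
  have hm : ∀ g : Γ, Measurable fun x : X => (g • x, x) := fun g =>
    (measurable_const_smul g).prodMk measurable_id
  have e : ∀ (g : Γ) {A B : Set X}, MeasurableSet A → MeasurableSet B →
      (μ.map fun x => (g • x, x)).real (A ×ˢ B) = μ.real ((g • ·) ⁻¹' A ∩ B) := by
    intro g A B hA hB
    rw [map_measureReal_apply (hm g) (hA.prod hB)]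
    rfl
  have hSm : ∀ A ∈ S, MeasurableSet A := fun A hA => by
    rw [← hgen]; exact MeasurableSpace.measurableSet_generateFrom hA
  have := tendsto_coupling_of_isPiSystem (l := l) (J := fun g : Γ => μ.map fun x => (g • x, x))
    (J' := μ.prod μ) (μ := μ) (ν := μ)
    (fun g => by
      rw [Measure.fst_map_prodMk measurable_id']; exact (measurePreserving_smul g μ).map_eq)
    (fun g => by
      rw [Measure.snd_map_prodMk (measurable_const_smul g)]; exact Measure.map_id)
    (by simp) (by simp) hS hgen hS hgen
    (fun A hA B hB => by
      simpa only [e _ (hSm A hA) (hSm B hB), measureReal_prod_prod] using h A hA B hB) hA hB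
  simpa only [e _ hA hB, measureReal_prod_prod] using this

lemma MixingAlong.prod [MeasurableConstSMul Γ X] [MeasurableConstSMul Γ Y] {l : Filter Γ}
    {μ : Measure X} {ν : Measure Y} [IsProbabilityMeasure μ] [IsProbabilityMeasure ν]
    [SMulInvariantMeasure Γ X μ] [SMulInvariantMeasure Γ Y ν]
    (hμ : MixingAlong l μ) (hν : MixingAlong l ν) : MixingAlong l (μ.prod ν) := by
  refine mixingAlong_of_isPiSystem isPiSystem_prod generateFrom_prod ?_
  rintro _ ⟨A, hA, C, hC, rfl⟩ _ ⟨B, hB, D, hD, rfl⟩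
  have e : ∀ g : Γ, (g • · : X × Y → X × Y) ⁻¹' (A ×ˢ C) ∩ (B ×ˢ D) =
      ((g • ·) ⁻¹' A ∩ B) ×ˢ ((g • ·) ⁻¹' C ∩ D) := by
    intro g; ext ⟨x, y⟩; simp; tauto
  simp only [e, measureReal_prod_prod]
  convert (hμ A B hA hB).mul (hν C D hC hD) using 2
  ring

/-- Almost invariant measurable sets of a mixing action are null or conull. -/
lemma MixingAlong.ae_mem_or_ae_notMem {l : Filter Γ} [l.NeBot] {μ : Measure X}
    [IsProbabilityMeasure μ] (hμ : MixingAlong l μ) {A : Set X} (hA : MeasurableSet A)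
    (hinv : ∀ g : Γ, ∀ᵐ x ∂μ, x ∈ A → g • x ∈ A) :
    (∀ᵐ x ∂μ, x ∈ A) ∨ ∀ᵐ x ∂μ, x ∉ A := by
  have h1 : ∀ g : Γ, μ.real ((g • ·) ⁻¹' A ∩ A) = μ.real A := fun g =>
    measureReal_congr (by
      filter_upwards [hinv g] with x hx
      exact propext ⟨fun h => h.2, fun h => ⟨hx h, h⟩⟩)
  have h2 := tendsto_nhds_unique (hμ A A hA hA) (by simp only [h1]; exact tendsto_const_nhds)
  have h3 : μ.real A = 1 ∨ μ.real A = 0 := by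
    rcases eq_or_ne (μ.real A) 0 with h | h
    · exact Or.inr h
    · left; field_simp at h2; exact h2
  rcases h3 with h | h
  · left
    rw [measureReal_def, ENNReal.toReal_eq_one_iff] at h
    exact (mem_ae_iff_prob_eq_one hA).2 h
  · right
    rw [measureReal_eq_zero_iff] at h
    exact measure_eq_zero_iff_ae_notMem.1 h

end Mixing

section LocalCohomology

open Filter

variable {Γ Λ Z : Type} [Group Γ] [Group Λ] [MeasurableSpace Λ] [MeasurableSpace Z] [MulAction Γ Z]

/-- Measurable cocycles over the action of `Γ` on `(Z, μ)`. -/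
structure IsMeasurableCocycle (μ : Measure Z) (α : Γ → Z → Λ) : Prop where
  measurable : ∀ g, Measurable (α g)
  map_mul : ∀ g h, ∀ᵐ z ∂μ, α (g * h) z = α g (h • z) * α h z

/-- Ergodicity, for almost invariant measurable sets. -/
def IsErgodicAction (Γ : Type) {Z : Type} [Group Γ] [MeasurableSpace Z] [MulAction Γ Z]
    (μ : Measure Z) : Prop :=
  ∀ A : Set Z, MeasurableSet A → (∀ g : Γ, ∀ᵐ z ∂μ, z ∈ A → g • z ∈ A) →
    (∀ᵐ z ∂μ, z ∈ A) ∨ ∀ᵐ z ∂μ, z ∉ A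

lemma IsMeasurableCocycle.map_one {μ : Measure Z} {α : Γ → Z → Λ}
    (hα : IsMeasurableCocycle μ α) : ∀ᵐ z ∂μ, α 1 z = 1 := by
  filter_upwards [hα.map_mul 1 1] with z hz
  simpa using hz

/-- The skew product action on `Z × Λ` associated with two cocycles. -/
def skewMap (α β : Γ → Z → Λ) (g : Γ) (q : Z × Λ) : Z × Λ :=
  (g • q.1, α g q.1 * q.2 * (β g q.1)⁻¹)

lemma skewMap_mul_ae {μ : Measure Z} [SFinite μ]
    {α β : Γ → Z → Λ} (hα : IsMeasurableCocycle μ α) (hβ : IsMeasurableCocycle μ β) (g h : Γ) :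
    ∀ᵐ q ∂μ.prod (Measure.count : Measure Λ),
      skewMap α β (g * h) q = skewMap α β g (skewMap α β h q) := by
  have := (Measure.quasiMeasurePreserving_fst (μ := μ) (ν := (Measure.count : Measure Λ))).ae
    ((hα.map_mul g h).and (hβ.map_mul g h))
  filter_upwards [this] with q hq
  simp only [skewMap, hq.1, hq.2, mul_smul, mul_inv_rev, mul_assoc]

/-- Measurable functions `Z → Λ` selecting the unique element of each fibre of a set. -/
lemma exists_measurable_unique_selection [Countable Λ] {P : Z → Λ → Prop}
    (hP : ∀ a, MeasurableSet {z | P z a}) :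
    ∃ f : Z → Λ, Measurable f ∧ MeasurableSet {z | ∃! a, P z a} ∧
      ∀ z, (∃! a, P z a) → ∀ a, P z a ↔ a = f z := by
  classical
  have hE : MeasurableSet {z | ∃! a, P z a} := by
    have : {z | ∃! a, P z a} = ⋃ a, ({z | P z a} ∩ ⋂ b, ({z | P z b}ᶜ ∪ {_z | b = a})) := by
      ext z
      simp [ExistsUnique, imp_iff_not_or]
    rw [this]
    exact MeasurableSet.iUnion fun a => (hP a).inter
      (MeasurableSet.iInter fun b => (hP b).compl.union (MeasurableSet.const _))
  have key : ∀ z, (∃! a, P z a) → ∀ a,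
      P z a ↔ a = if h : ∃! a, P z a then h.choose else 1 := by
    intro z h a
    rw [dif_pos h]
    exact ⟨fun ha => h.choose_spec.2 a ha, fun ha => ha ▸ h.choose_spec.1⟩
  refine ⟨fun z => if h : ∃! a, P z a then h.choose else 1, ?_, hE, key⟩
  refine measurable_to_countable' fun a => ?_
  have : (fun z => if h : ∃! a, P z a then h.choose else 1) ⁻¹' {a} =
      ({z | ∃! a, P z a} ∩ {z | P z a}) ∪ ({z | ∃! a, P z a}ᶜ ∩ {_z | a = 1}) := by
    ext z
    by_cases h : ∃! a, P z a
    · have := key z h a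
      simp only [Set.mem_preimage, Set.mem_singleton_iff, Set.mem_union, Set.mem_inter_iff,
        Set.mem_ofPred_eq, Set.mem_compl_iff, h, not_true, true_and, false_and, or_false]
      rw [this, eq_comm, dif_pos trivial, dif_pos h]
    · simp only [Set.mem_preimage, Set.mem_singleton_iff, Set.mem_union, Set.mem_inter_iff,
        Set.mem_ofPred_eq, Set.mem_compl_iff, h, not_false_iff, true_and, false_and, false_or,
        dif_neg, eq_comm]
  rw [this]
  exact (hE.inter (hP a)).union (hE.compl.inter (MeasurableSet.const _))

variable [DiscreteMeasurableSpace Λ] [Countable Λ] [MeasurableConstSMul Γ Z]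

lemma measurePreserving_skewMap {μ : Measure Z} [SFinite μ] [SMulInvariantMeasure Γ Z μ]
    {α β : Γ → Z → Λ} (hα : ∀ g, Measurable (α g)) (hβ : ∀ g, Measurable (β g)) (g : Γ) :
    MeasurePreserving (skewMap α β g) (μ.prod Measure.count) (μ.prod Measure.count) := by
  refine (measurePreserving_smul g μ).skew_product
    (g := fun z a => α g z * a * (β g z)⁻¹) ?_ (ae_of_all _ fun z => ?_)
  · exact (((hα g).comp measurable_fst).mul measurable_snd).mul ((hβ g).comp measurable_fst).inv
  · let e : Λ ≃ Λ := (Equiv.mulLeft (α g z)).trans (Equiv.mulRight (β g z)⁻¹)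
    have : (fun a => α g z * a * (β g z)⁻¹) = e := rfl
    rw [this]
    ext s hs
    rw [Measure.map_apply (measurable_of_countable e) hs,
      Measure.count_apply hs, Measure.count_apply (measurable_of_countable e hs),
      Set.encard_preimage_of_bijective e.bijective]

/-- The unitary representation on `L²(Z × Λ)` associated with two cocycles. -/
noncomputable def cocycleRep {μ : Measure Z} [SFinite μ] [SMulInvariantMeasure Γ Z μ]
    {α β : Γ → Z → Λ} (hα : IsMeasurableCocycle μ α) (hβ : IsMeasurableCocycle μ β) (g : Γ) :
    Lp ℂ 2 (μ.prod (Measure.count : Measure Λ)) →ₗᵢ[ℂ]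
      Lp ℂ 2 (μ.prod (Measure.count : Measure Λ)) :=
  Lp.compMeasurePreservingₗᵢ ℂ (skewMap α β g⁻¹)
    (measurePreserving_skewMap hα.measurable hβ.measurable g⁻¹)

section

variable {μ : Measure Z} [SFinite μ] [SMulInvariantMeasure Γ Z μ]
    {α β : Γ → Z → Λ} (hα : IsMeasurableCocycle μ α) (hβ : IsMeasurableCocycle μ β)

lemma cocycleRep_coeFn (g : Γ) (v : Lp ℂ 2 (μ.prod (Measure.count : Measure Λ))) :
    cocycleRep hα hβ g v =ᵐ[μ.prod Measure.count] v ∘ skewMap α β g⁻¹ :=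
  Lp.coeFn_compMeasurePreserving _ _

lemma cocycleRep_one (v : Lp ℂ 2 (μ.prod (Measure.count : Measure Λ))) :
    cocycleRep hα hβ 1 v = v := by
  refine Lp.ext ?_
  have := (Measure.quasiMeasurePreserving_fst (μ := μ) (ν := (Measure.count : Measure Λ))).ae
    (hα.map_one.and hβ.map_one)
  filter_upwards [cocycleRep_coeFn hα hβ 1 v, this] with q hq h
  rw [hq]
  simp [skewMap, h.1, h.2]

lemma cocycleRep_mul (g h : Γ) (v : Lp ℂ 2 (μ.prod (Measure.count : Measure Λ))) :
    cocycleRep hα hβ (g * h) v = cocycleRep hα hβ g (cocycleRep hα hβ h v) := by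
  refine Lp.ext ?_
  have hmp := measurePreserving_skewMap (μ := μ) hα.measurable hβ.measurable g⁻¹
  filter_upwards [cocycleRep_coeFn hα hβ (g * h) v,
    cocycleRep_coeFn hα hβ g (cocycleRep hα hβ h v),
    hmp.quasiMeasurePreserving.ae (cocycleRep_coeFn hα hβ h v),
    skewMap_mul_ae hα hβ h⁻¹ g⁻¹] with q h1 h2 h3 h4
  rw [h1, h2, Function.comp_apply, Function.comp_apply, h3, Function.comp_apply, ← h4, mul_inv_rev]

end

/-- An invariant vector close to the indicator function of `Z × {1}` gives a cohomology between
the two cocycles. -/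
lemma exists_cohomology_of_invariant {μ : Measure Z} [IsProbabilityMeasure μ]
    [SMulInvariantMeasure Γ Z μ] (herg : IsErgodicAction Γ μ)
    {α β : Γ → Z → Λ} (hα : IsMeasurableCocycle μ α) (hβ : IsMeasurableCocycle μ β)
    (w : Lp ℂ 2 (μ.prod (Measure.count : Measure Λ))) (hw : ∀ g, cocycleRep hα hβ g w = w)
    (hs : MeasurableSet (Set.univ ×ˢ {1} : Set (Z × Λ)))
    (hs' : μ.prod Measure.count (Set.univ ×ˢ {1} : Set (Z × Λ)) ≠ ⊤)
    (hclose : ‖indicatorConstLp 2 hs hs' (1 : ℂ) - w‖ < 1 / 2) :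
    ∃ f : Z → Λ, Measurable f ∧ ∀ g, ∀ᵐ z ∂μ, α g z * f z = f (g • z) * β g z := by
  classical
  have hwm : Measurable (w : Z × Λ → ℂ) := (Lp.stronglyMeasurable w).measurable
  obtain ⟨f, hf, hE, hfE⟩ := exists_measurable_unique_selection
    (P := fun (z : Z) (a : Λ) => 1 / 2 < ‖w (z, a)‖) (fun a =>
      measurableSet_lt measurable_const
        ((hwm.comp (measurable_id.prodMk measurable_const)).norm))
  have hinv : ∀ g : Γ, ∀ᵐ z ∂μ, ∀ a, w (skewMap α β g (z, a)) = w (z, a) := by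
    intro g
    have h1 := cocycleRep_coeFn hα hβ g⁻¹ w
    rw [hw, inv_inv] at h1
    filter_upwards [Measure.ae_ae_of_ae_prod h1] with z hz a
    exact (Measure.ae_count_iff.1 hz a).symm
  have hequiv : ∀ g : Γ, ∀ᵐ z ∂μ, ∀ a, 1 / 2 < ‖w (z, a)‖ ↔
      1 / 2 < ‖w (g • z, α g z * a * (β g z)⁻¹)‖ := by
    intro g
    filter_upwards [hinv g] with z hz a
    rw [← hz a]; rfl
  have hEinv : ∀ g : Γ, ∀ᵐ z ∂μ, z ∈ {z | ∃! a, 1 / 2 < ‖w (z, a)‖} →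
      g • z ∈ {z | ∃! a, 1 / 2 < ‖w (z, a)‖} := by
    intro g
    filter_upwards [hequiv g] with z hz hzE
    obtain ⟨a, ha, hau⟩ := hzE
    refine ⟨α g z * a * (β g z)⁻¹, (hz a).1 ha, fun b hb => ?_⟩
    have := hau ((α g z)⁻¹ * b * β g z) ((hz _).2 (by simpa [mul_assoc] using hb))
    rw [← this]; group
  have hEall : ∀ᵐ z ∂μ, ∃! a, 1 / 2 < ‖w (z, a)‖ := by
    refine (herg _ hE hEinv).resolve_right fun hnull => ?_
    set s : Set (Z × Λ) := Set.univ ×ˢ {1} with hsdef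
    let d : Z × Λ → ℂ := fun q => s.indicator (fun _ => (1 : ℂ)) q - w q
    have hdm : Measurable d := (measurable_const.indicator hs).sub hwm
    have hd : eLpNorm d 2 (μ.prod Measure.count) < ENNReal.ofReal (1 / 2) := by
      have : eLpNorm d 2 (μ.prod Measure.count) =
          eLpNorm (indicatorConstLp 2 hs hs' (1 : ℂ) - w) 2 (μ.prod Measure.count) := by
        refine eLpNorm_congr_ae ?_
        filter_upwards [indicatorConstLp_coeFn (p := 2) (hs := hs) (hμs := hs') (c := (1 : ℂ)),
          Lp.coeFn_sub (indicatorConstLp 2 hs hs' (1 : ℂ)) w] with q h1 h2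
        rw [h2, Pi.sub_apply, h1]
      rw [this, ← Lp.enorm_def, ← ofReal_norm]
      exact (ENNReal.ofReal_lt_ofReal_iff (by norm_num)).2 hclose
    have hcheb := mul_meas_ge_le_pow_eLpNorm' (μ.prod (Measure.count : Measure Λ))
      (p := 2) (by norm_num) (by norm_num) hdm.aestronglyMeasurable (ENNReal.ofReal (1 / 2))
    set D := {q | ENNReal.ofReal (1 / 2) ≤ ‖d q‖ₑ} with hD
    have hDm : MeasurableSet D := measurableSet_le measurable_const hdm.enorm
    have hlarge : 1 ≤ μ.prod Measure.count D := by
      rw [Measure.prod_apply hDm]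
      calc (1 : ENNReal) = ∫⁻ _, 1 ∂μ := by simp
        _ ≤ _ := by
          refine lintegral_mono_ae ?_
          filter_upwards [hnull] with z hz
          by_contra! hlt
          refine hz ?_
          have hempty : Prod.mk z ⁻¹' D = ∅ := by
            have h0 : Measure.count (Prod.mk z ⁻¹' D) = 0 := by
              rw [Measure.count_apply (measurable_prodMk_left hDm)] at hlt ⊢
              have : (Prod.mk z ⁻¹' D).encard < 1 := by exact_mod_cast hlt
              simpa using this
            exact Measure.count_eq_zero_iff.1 h0
          have hsmall : ∀ a, ‖d (z, a)‖ < 1 / 2 := by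
            intro a
            have : (z, a) ∉ D := fun h => by
              have : a ∈ Prod.mk z ⁻¹' D := h
              simp [hempty] at this
            simp only [hD, Set.mem_ofPred_eq, not_le, ← ofReal_norm] at this
            exact (ENNReal.ofReal_lt_ofReal_iff (by norm_num)).1 this
          refine ⟨1, ?_, fun a ha => ?_⟩
          · have h1 := hsmall 1
            have h2 : d (z, 1) = 1 - w (z, 1) := by simp [d, hsdef]
            have h3 := norm_sub_norm_le (1 : ℂ) (w (z, 1))
            rw [h2] at h1
            simp only [norm_one] at h3
            linarith
          · by_contra hne
            have h1 := hsmall a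
            have h2 : d (z, a) = - w (z, a) := by simp [d, hsdef, hne]
            rw [h2, norm_neg] at h1
            exact absurd h1 (not_lt.2 (le_of_lt ha))
    have h3 : ENNReal.ofReal (1 / 2) ^ (2 : ENNReal).toReal ≤
        eLpNorm d 2 (μ.prod Measure.count) ^ (2 : ENNReal).toReal :=
      le_trans (le_mul_of_one_le_right' hlarge) hcheb
    exact absurd h3 (not_le.2 (ENNReal.rpow_lt_rpow hd (by norm_num)))
  refine ⟨f, hf, fun g => ?_⟩
  filter_upwards [hEall, hequiv g, (measurePreserving_smul g μ).quasiMeasurePreserving.ae hEall]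
    with z h1 h2 h3
  have := (hfE _ h3 _).1 ((h2 _).1 ((hfE z h1 (f z)).2 rfl))
  rw [← this]; group

/-- Cocycles that are close on a suitable finite set are cohomologous. -/
theorem HasPropertyT.exists_cohomology_of_close [Countable Γ] (hT : HasPropertyT Γ) (Λ : Type)
    [Group Λ] [Countable Λ] [MeasurableSpace Λ] [DiscreteMeasurableSpace Λ] :
    ∃ (F : Finset Γ) (ε : ℝ), 0 < ε ∧
      ∀ (Z : Type) [MeasurableSpace Z] [MulAction Γ Z] [MeasurableConstSMul Γ Z]
        (μ : Measure Z) [IsProbabilityMeasure μ] [SMulInvariantMeasure Γ Z μ]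
        (_ : IsErgodicAction Γ μ) (α β : Γ → Z → Λ)
        (_ : IsMeasurableCocycle μ α) (_ : IsMeasurableCocycle μ β)
        (_ : ∀ g ∈ F, μ.real {z | α g z ≠ β g z} < ε),
        ∃ f : Z → Λ, Measurable f ∧ ∀ g, ∀ᵐ z ∂μ, α g z * f z = f (g • z) * β g z := by
  classical
  obtain ⟨F, ε, hε, hF⟩ := hT.exists_kazhdan_pair (δ := 1 / 2) (by norm_num)
  refine ⟨F.image (·⁻¹), ε ^ 2 / 2, by positivity, ?_⟩
  intro Z _ _ _ μ _ _ herg α β hα hβ hclose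
  have hs : MeasurableSet (Set.univ ×ˢ {1} : Set (Z × Λ)) :=
    MeasurableSet.univ.prod (MeasurableSet.singleton 1)
  have hs' : μ.prod Measure.count (Set.univ ×ˢ {1} : Set (Z × Λ)) ≠ ⊤ := by
    simp [Measure.prod_prod]
  obtain ⟨w, hw, hd⟩ := hF _ (cocycleRep hα hβ) (cocycleRep_one hα hβ) (cocycleRep_mul hα hβ)
    (indicatorConstLp 2 hs hs' (1 : ℂ)) (by
      intro g hg
      have hmp := measurePreserving_skewMap (μ := μ) hα.measurable hβ.measurable g⁻¹
      have h1 : cocycleRep hα hβ g (indicatorConstLp 2 hs hs' (1 : ℂ)) =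
          indicatorConstLp 2 (hs.preimage hmp.measurable)
            (by rwa [hmp.measure_preimage hs.nullMeasurableSet]) (1 : ℂ) := rfl
      rw [h1, ← dist_eq_norm, dist_indicatorConstLp_eq_norm, norm_indicatorConstLp (by norm_num)
        (by norm_num)]
      set N : Set Z := {z | α g⁻¹ z ≠ β g⁻¹ z} with hN
      have hNm : MeasurableSet N :=
        (measurableSet_eq_fun (hα.measurable _) (hβ.measurable _)).compl
      have hbound : (μ.prod Measure.count) (symmDiff
          (skewMap α β g⁻¹ ⁻¹' (Set.univ ×ˢ {1} : Set (Z × Λ))) (Set.univ ×ˢ {1})) ≤ 2 * μ N := by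
        rw [Measure.prod_apply ((hs.preimage hmp.measurable).symmDiff hs)]
        calc _ ≤ ∫⁻ z, N.indicator (fun _ => 2) z ∂μ := by
              refine lintegral_mono fun z => ?_
              by_cases hz : z ∈ N
              · rw [Set.indicator_of_mem hz]
                have hsub : Prod.mk z ⁻¹' (symmDiff
                    (skewMap α β g⁻¹ ⁻¹' (Set.univ ×ˢ {1} : Set (Z × Λ))) (Set.univ ×ˢ {1})) ⊆
                    (({1, (α g⁻¹ z)⁻¹ * β g⁻¹ z} : Finset Λ) : Set Λ) := by
                  intro a ha
                  simp only [Set.mem_preimage, Set.mem_symmDiff, skewMap, Set.mem_prod,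
                    Set.mem_univ, true_and, Set.mem_singleton_iff] at ha
                  simp only [Finset.coe_insert, Finset.coe_singleton, Set.mem_insert_iff,
                    Set.mem_singleton_iff]
                  rcases ha with ha | ha
                  · right
                    rw [eq_inv_mul_iff_mul_eq]
                    exact mul_inv_eq_one.1 ha.1
                  · exact Or.inl ha.1
                refine (measure_mono hsub).trans ?_
                rw [Measure.count_apply_finset]
                exact_mod_cast Finset.card_le_two
              · have hz' : α g⁻¹ z = β g⁻¹ z := by simpa [hN] using hz
                have hempty : Prod.mk z ⁻¹' (symmDiff
                    (skewMap α β g⁻¹ ⁻¹' (Set.univ ×ˢ {1} : Set (Z × Λ))) (Set.univ ×ˢ {1})) =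
                    ∅ := by
                  ext a
                  simp [Set.mem_symmDiff, skewMap, hz', mul_inv_eq_one]
                rw [hempty]; simp
          _ = 2 * μ N := by rw [lintegral_indicator_const hNm]
      have hreal : (μ.prod Measure.count).real (symmDiff
          (skewMap α β g⁻¹ ⁻¹' (Set.univ ×ˢ {1} : Set (Z × Λ))) (Set.univ ×ˢ {1})) < ε ^ 2 := by
        calc _ ≤ (2 * μ N).toReal :=
              ENNReal.toReal_mono (ENNReal.mul_ne_top (by norm_num) (measure_ne_top _ _)) hbound
          _ = 2 * μ.real N := by simp [measureReal_def]
          _ < ε ^ 2 := by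
              have := hclose g⁻¹ (Finset.mem_image_of_mem _ hg)
              linarith
      rw [norm_one, one_mul, show (1 / (2 : ENNReal).toReal) = 1 / 2 by simp, ← Real.sqrt_eq_rpow]
      exact (Real.sqrt_lt' hε).2 hreal)
  exact exists_cohomology_of_invariant herg hα hβ w hw hs hs' hd

end LocalCohomology

section Bernoulli

open Filter Topology

variable {Γ I Y Y' : Type} [Group Γ] [MulAction Γ I]

/-- The filter on `Γ` generated by the sets of elements moving a finite subset of `I` off itself. -/
def escapeFilter (Γ I : Type) [Group Γ] [MulAction Γ I] : Filter Γ :=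
  ⨅ s : Finset I, 𝓟 {g | ∀ a ∈ s, g • a ∉ s}

lemma eventually_escapeFilter (s : Finset I) :
    ∀ᶠ g in escapeFilter Γ I, ∀ a ∈ s, g • a ∉ s :=
  mem_iInf_of_mem s (mem_principal_self _)

lemma escapeFilter_neBot (h : ∀ i : I, (MulAction.stabilizer Γ i).index = 0) :
    (escapeFilter Γ I).NeBot := by
  classical
  refine iInf_neBot_of_directed (fun s t => ⟨s ∪ t, ?_, ?_⟩) fun s => ?_
  · exact principal_mono.2 fun g hg a ha hga =>
      hg a (Finset.mem_union_left _ ha) (Finset.mem_union_left _ hga)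
  · exact principal_mono.2 fun g hg a ha hga =>
      hg a (Finset.mem_union_right _ ha) (Finset.mem_union_right _ hga)
  · rw [principal_neBot_iff]
    by_contra! hempty
    have hex : ∀ p : I × I, ∃ g : Γ, (∃ k : Γ, k • p.1 = p.2) → g • p.1 = p.2 := fun p => by
      by_cases hp : ∃ k : Γ, k • p.1 = p.2
      · exact ⟨hp.choose, fun _ => hp.choose_spec⟩
      · exact ⟨1, fun h => absurd h hp⟩
    choose g hg using hex
    obtain ⟨p, -, hp⟩ := Subgroup.exists_finiteIndex_of_leftCoset_cover (G := Γ)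
      (H := fun p : I × I => MulAction.stabilizer Γ p.1) (g := g) (s := s ×ˢ s) (by
        rw [Set.eq_univ_iff_forall]
        intro k
        have hk : k ∉ {g : Γ | ∀ a ∈ s, g • a ∉ s} := by rw [hempty]; exact Set.notMem_empty k
        simp only [Set.mem_ofPred_eq, not_forall, not_not] at hk
        obtain ⟨a, ha, hka⟩ := hk
        simp only [Set.mem_iUnion]
        refine ⟨(a, k • a), Finset.mk_mem_product ha hka, ?_⟩
        rw [mem_leftCoset_iff, SetLike.mem_coe, MulAction.mem_stabilizer_iff, mul_smul,
          inv_smul_eq_iff]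
        exact (hg (a, k • a) ⟨k, rfl⟩).symm)
    exact hp.index_ne_zero (h p.1)

attribute [local instance] arrowAction

lemma smul_preimage_pi (g : Γ) [DecidableEq I] (s : Finset I) (t : I → Set Y) :
    (g • · : (I → Y) → (I → Y)) ⁻¹' (s : Set I).pi t =
      ((s.image (g⁻¹ • ·) : Finset I) : Set I).pi fun i => t (g • i) := by
  ext x
  simp only [Set.mem_preimage, Set.mem_pi, Finset.coe_image, Set.forall_mem_image,
    smul_inv_smul]
  rfl

variable [MeasurableSpace Y] [MeasurableSpace Y']

instance : MeasurableConstSMul Γ (I → Y) :=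
  ⟨fun g => measurable_pi_lambda _ fun i => measurable_pi_apply (g⁻¹ • i)⟩

variable {ν : Measure Y} [IsProbabilityMeasure ν] {ν' : Measure Y'} [IsProbabilityMeasure ν']

lemma infinitePi_smul_preimage_pi (g : Γ) (s : Finset I) {t : I → Set Y}
    (ht : ∀ i, MeasurableSet (t i)) :
    Measure.infinitePi (fun _ : I => ν) ((g • · : (I → Y) → (I → Y)) ⁻¹' (s : Set I).pi t) =
      ∏ i ∈ s, ν (t i) := by
  classical
  rw [smul_preimage_pi, Measure.infinitePi_pi _ fun i _ => ht _,
    Finset.prod_image fun i _ j _ h => MulAction.injective g⁻¹ h]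
  simp

instance : SMulInvariantMeasure Γ (I → Y) (Measure.infinitePi fun _ : I => ν) := by
  have h : ∀ g : Γ, (Measure.infinitePi fun _ : I => ν).map (g • ·) =
      Measure.infinitePi fun _ : I => ν := fun g =>
    Measure.eq_infinitePi _ fun s t ht => by
      rw [Measure.map_apply (measurable_const_smul g)
        (.pi s.countable_toSet fun i _ => ht i), infinitePi_smul_preimage_pi g s ht]
  refine ⟨fun g s hs => ?_⟩
  rw [← Measure.map_apply (measurable_const_smul g) hs, h]

lemma mixingAlong_infinitePi :
    MixingAlong (escapeFilter Γ I) (Measure.infinitePi fun _ : I => ν) := by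
  classical
  refine mixingAlong_of_isPiSystem
    (isPiSystem_squareCylinders (fun _ => MeasurableSpace.isPiSystem_measurableSet) (by simp))
    generateFrom_squareCylinders ?_
  rintro _ ⟨s, (A : I → Set Y), hA, rfl⟩ _ ⟨t, (B : I → Set Y), hB, rfl⟩
  replace hA : ∀ i, MeasurableSet (A i) := fun i => hA i trivial
  replace hB : ∀ i, MeasurableSet (B i) := fun i => hB i trivial
  refine tendsto_const_nhds.congr' ?_
  filter_upwards [eventually_escapeFilter (s ∪ t)] with g hg
  set s' := s.image (g⁻¹ • ·) with hs'
  have hd : Disjoint s' t := by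
    rw [Finset.disjoint_left]
    intro i hi hit
    obtain ⟨j, hj, rfl⟩ := Finset.mem_image.1 hi
    exact hg _ (Finset.mem_union_right _ hit) (by simpa using Or.inl hj)
  have e : (g • · : (I → Y) → (I → Y)) ⁻¹' (s : Set I).pi A ∩ (t : Set I).pi B =
      ((s' ∪ t : Finset I) : Set I).pi (s'.piecewise (fun i => A (g • i)) B) := by
    rw [smul_preimage_pi, ← hs', Finset.coe_union, Set.union_pi]
    congr 1
    · exact Set.pi_congr rfl fun i hi => by simp [Finset.piecewise, Finset.mem_coe.1 hi]
    · exact Set.pi_congr rfl fun i hi => by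
        simp [Finset.piecewise, Finset.disjoint_right.1 hd (Finset.mem_coe.1 hi)]
  simp only [measureReal_def]
  have hm : ∀ i, MeasurableSet (s'.piecewise (fun i => A (g • i)) B i) := fun i => by
    by_cases h : i ∈ s' <;> simp [Finset.piecewise, h, hA, hB]
  rw [e, Measure.infinitePi_pi _ fun i _ => hm i, Measure.infinitePi_pi _ fun i _ => hA i,
    Measure.infinitePi_pi _ fun i _ => hB i, Finset.prod_union hd, ENNReal.toReal_mul]
  · congr 2
    · rw [hs', Finset.prod_image fun i _ j _ h => MulAction.injective g⁻¹ h]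
      refine Finset.prod_congr rfl fun i hi => ?_
      have : g⁻¹ • i ∈ s' := Finset.mem_image_of_mem _ hi
      simp [Finset.piecewise, ← hs', this]
    · refine Finset.prod_congr rfl fun i hi => ?_
      simp [Finset.piecewise, Finset.disjoint_right.1 hd hi]

/-- Pairing families identifies the product of two Bernoulli measures with a Bernoulli measure. -/
lemma measurePreserving_pairing :
    MeasurePreserving (fun (p : (I → Y) × (I → Y')) (i : I) => (p.1 i, p.2 i))
      ((Measure.infinitePi fun _ : I => ν).prod (Measure.infinitePi fun _ : I => ν'))
      (Measure.infinitePi fun _ : I => ν.prod ν') := by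
  classical
  have hE : Measurable fun (q : I → Y × Y') => ((fun i => (q i).1, fun i => (q i).2) :
      (I → Y) × (I → Y')) := by fun_prop
  have hP : Measurable fun (p : (I → Y) × (I → Y')) (i : I) => (p.1 i, p.2 i) := by fun_prop
  have key : (Measure.infinitePi fun _ : I => ν).prod (Measure.infinitePi fun _ : I => ν') =
      (Measure.infinitePi fun _ : I => ν.prod ν').map
        fun q => (fun i => (q i).1, fun i => (q i).2) := by
    have hfin : ∀ {Z : Type} [MeasurableSpace Z] (τ : Measure Z) [IsProbabilityMeasure τ],
      (Measure.infinitePi fun _ : I => τ).FiniteSpanningSetsIn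
        (squareCylinders fun _ : I => {s : Set Z | MeasurableSet s}) := fun τ _ =>
      ⟨fun _ => Set.univ, fun _ => ⟨∅, fun _ => Set.univ, by simp, by simp⟩, by simp, by
        simp [Set.iUnion_const]⟩
    refine Measure.prod_eq_generateFrom generateFrom_squareCylinders generateFrom_squareCylinders
      (isPiSystem_squareCylinders (fun _ => MeasurableSpace.isPiSystem_measurableSet) (by simp))
      (isPiSystem_squareCylinders (fun _ => MeasurableSpace.isPiSystem_measurableSet) (by simp))
      (hfin ν) (hfin ν') ?_
    rintro _ ⟨s, A, hA, rfl⟩ _ ⟨t, B, hB, rfl⟩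
    replace hA : ∀ i, MeasurableSet (A i) := fun i => hA i trivial
    replace hB : ∀ i, MeasurableSet (B i) := fun i => hB i trivial
    rw [Measure.map_apply hE ((MeasurableSet.pi s.countable_toSet fun i _ => hA i).prod
      (.pi t.countable_toSet fun i _ => hB i))]
    have e : (fun (q : I → Y × Y') => ((fun i => (q i).1, fun i => (q i).2) :
        (I → Y) × (I → Y'))) ⁻¹' ((s : Set I).pi A ×ˢ (t : Set I).pi B) =
        ((s ∪ t : Finset I) : Set I).pi fun i =>
          (if i ∈ s then A i else Set.univ) ×ˢ (if i ∈ t then B i else Set.univ) := by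
      ext q
      simp only [Set.mem_preimage, Set.mem_prod, Set.mem_pi, Finset.coe_union, Set.mem_union,
        Finset.mem_coe]
      constructor
      · rintro ⟨h1, h2⟩ i -
        constructor
        · split_ifs with h
          exacts [h1 i h, trivial]
        · split_ifs with h
          exacts [h2 i h, trivial]
      · intro h
        exact ⟨fun i hi => by simpa [hi] using (h i (Or.inl hi)).1,
          fun i hi => by simpa [hi] using (h i (Or.inr hi)).2⟩
    rw [e, Measure.infinitePi_pi _ fun i _ => by
        refine MeasurableSet.prod ?_ ?_ <;> split_ifs <;> simp [hA, hB],
      Measure.infinitePi_pi _ fun i _ => hA i, Measure.infinitePi_pi _ fun i _ => hB i]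
    simp only [Measure.prod_prod, Finset.prod_mul_distrib]
    congr 1
    · rw [← Finset.prod_subset (Finset.subset_union_left (s₁ := s) (s₂ := t))
        fun i _ hi => by simp [hi]]
      exact Finset.prod_congr rfl fun i hi => by simp [hi]
    · rw [← Finset.prod_subset (Finset.subset_union_right (s₁ := s) (s₂ := t))
        fun i _ hi => by simp [hi]]
      exact Finset.prod_congr rfl fun i hi => by simp [hi]
  refine ⟨hP, ?_⟩
  rw [key, Measure.map_map hP hE]
  exact Measure.map_id

end Bernoulli

section Splitting

open Filter

variable {Γ Λ X Y : Type} [Group Γ] [Group Λ] [Countable Λ] [MeasurableSpace Λ]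
  [DiscreteMeasurableSpace Λ] [MeasurableSpace X] [MeasurableSpace Y] [MulAction Γ X]
  [MulAction Γ Y]

lemma ae_of_ae_prod_fst {μ : Measure X} {ν : Measure Y} [SFinite ν] [NeZero ν]
    {P : X → Prop} (h : ∀ᵐ p ∂μ.prod ν, P p.1) : ∀ᵐ x ∂μ, P x := by
  filter_upwards [Measure.ae_ae_of_ae_prod h] with x hx
  exact hx.exists.choose_spec

/-- A function on `X × Y` transforming under `Γ` by multipliers that do not depend on the second
coordinate does not depend on the second coordinate itself, if `X × Y × Y` is ergodic. -/
lemma exists_ae_eq_comp_fst {μ : Measure X} {ν : Measure Y} [IsProbabilityMeasure μ]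
    [IsProbabilityMeasure ν]
    (herg : IsErgodicAction Γ (μ.prod (ν.prod ν))) {F : X × Y → Λ} (hF : Measurable F)
    (β γ : Γ → X → Λ) (h : ∀ g : Γ, ∀ᵐ p ∂μ.prod ν, F (g • p) = β g p.1 * F p * γ g p.1) :
    ∃ H : X → Λ, Measurable H ∧ ∀ᵐ p ∂μ.prod ν, F p = H p.1 := by
  have m1 : MeasurePreserving (fun q : X × (Y × Y) => (q.1, q.2.1)) (μ.prod (ν.prod ν))
      (μ.prod ν) := (MeasurePreserving.id μ).prod measurePreserving_fst
  have m2 : MeasurePreserving (fun q : X × (Y × Y) => (q.1, q.2.2)) (μ.prod (ν.prod ν))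
      (μ.prod ν) := (MeasurePreserving.id μ).prod measurePreserving_snd
  set E : Set (X × (Y × Y)) := {q | F (q.1, q.2.1) = F (q.1, q.2.2)} with hEdef
  have hE : MeasurableSet E :=
    measurableSet_eq_fun (hF.comp m1.measurable) (hF.comp m2.measurable)
  have hinv : ∀ g : Γ, ∀ᵐ q ∂μ.prod (ν.prod ν), q ∈ E → g • q ∈ E := fun g => by
    filter_upwards [m1.quasiMeasurePreserving.ae (h g), m2.quasiMeasurePreserving.ae (h g)]
      with q h1 h2 hq
    have e : F (q.1, q.2.1) = F (q.1, q.2.2) := hq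
    change F (g • (q.1, q.2.1)) = F (g • (q.1, q.2.2))
    rw [h1, h2, e]
  rcases herg E hE hinv with hc | hn
  · have m3 : MeasurePreserving (fun q : Y × (X × Y) => ((q.2.1, (q.2.2, q.1)) : X × (Y × Y)))
        (ν.prod (μ.prod ν)) (μ.prod (ν.prod ν)) :=
      (measurePreserving_prodAssoc μ ν ν).comp Measure.measurePreserving_swap
    obtain ⟨y, hy⟩ := (Measure.ae_ae_of_ae_prod (m3.quasiMeasurePreserving.ae hc)).exists
    exact ⟨fun x => F (x, y), hF.comp (measurable_id.prodMk measurable_const), hy⟩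
  · obtain ⟨x, hx⟩ := (Measure.ae_ae_of_ae_prod hn).exists
    exfalso
    have hnull : ∀ a : Λ, ν {y | F (x, y) = a} = 0 := fun a => by
      have : (ν.prod ν) ({y | F (x, y) = a} ×ˢ {y | F (x, y) = a}) = 0 :=
        measure_mono_null (fun p hp => by
          simp only [Set.mem_compl_iff, Set.mem_ofPred_eq, not_not]
          exact (hp.1.trans hp.2.symm : F (x, p.1) = F (x, p.2))) hx
      simpa using this
    have huniv : (Set.univ : Set Y) = ⋃ a : Λ, {y | F (x, y) = a} := by ext; simp
    have : ν Set.univ = 0 := by rw [huniv]; exact measure_iUnion_null hnull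
    simp at this

lemma MixingAlong.isErgodicAction {l : Filter Γ} [l.NeBot] {μ : Measure X}
    [IsProbabilityMeasure μ] (hμ : MixingAlong l μ) : IsErgodicAction Γ μ :=
  fun _ hA hinv => hμ.ae_mem_or_ae_notMem hA hinv

variable [MeasurableConstSMul Γ X] [MeasurableConstSMul Γ Y]

/-- If the two pull-backs of a cocycle to `X × X` become cohomologous on a mixing extension
`(X × X) × Y`, then the cocycle is cohomologous to a homomorphism. -/
theorem IsMeasurableCocycle.exists_hom_of_cohomology {l : Filter Γ} [l.NeBot] {μ : Measure X}
    {ν : Measure Y} [IsProbabilityMeasure μ] [IsProbabilityMeasure ν]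
    [SMulInvariantMeasure Γ X μ] [SMulInvariantMeasure Γ Y ν] (hμ : MixingAlong l μ)
    (hν : MixingAlong l ν) {α : Γ → X → Λ} (hα : IsMeasurableCocycle μ α) {f : (X × X) × Y → Λ}
    (hf : Measurable f) (h : ∀ g : Γ, ∀ᵐ z ∂(μ.prod μ).prod ν,
      α g z.1.1 * f z = f (g • z) * α g z.1.2) :
    ∃ (ρ : Γ →* Λ) (φ : X → Λ), Measurable φ ∧
      ∀ g : Γ, ∀ᵐ x ∂μ, α g x = φ (g • x) * ρ g * (φ x)⁻¹ := by
  obtain ⟨F, hF, hfF⟩ := exists_ae_eq_comp_fst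
    ((hμ.prod hμ).prod (hν.prod hν)).isErgodicAction hf (fun g p => α g p.1)
    (fun g p => (α g p.2)⁻¹) (fun g => by
      filter_upwards [h g] with z hz
      rw [hz, mul_inv_cancel_right])
  have hFc : ∀ g : Γ, ∀ᵐ p ∂μ.prod μ, α g p.1 * F p = F (g • p) * α g p.2 := fun g => by
    refine ae_of_ae_prod_fst (ν := ν) ?_
    filter_upwards [h g, hfF, (measurePreserving_smul g
      ((μ.prod μ).prod ν)).quasiMeasurePreserving.ae hfF] with z h1 h2 h3
    rw [← h2, h1, h3]
    rfl
  obtain ⟨φ, ψ, hφ, hψ, hφψ⟩ : ∃ φ ψ : X → Λ, Measurable φ ∧ Measurable ψ ∧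
      ∀ᵐ p ∂μ.prod μ, F p = φ p.1 * ψ p.2 := by
    have m1 : MeasurePreserving (fun q : (X × X) × X => (q.2, q.1.1)) ((μ.prod μ).prod μ)
        (μ.prod μ) := Measure.measurePreserving_swap.comp
          (measurePreserving_fst.prod (MeasurePreserving.id μ))
    have m2 : MeasurePreserving (fun q : (X × X) × X => (q.2, q.1.2)) ((μ.prod μ).prod μ)
        (μ.prod μ) := Measure.measurePreserving_swap.comp
          (measurePreserving_snd.prod (MeasurePreserving.id μ))
    obtain ⟨θ, hθ, hFθ⟩ := exists_ae_eq_comp_fst (Λ := Λ)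
      ((hμ.prod hμ).prod (hμ.prod hμ)).isErgodicAction
      (F := fun q : (X × X) × X => (F (q.2, q.1.1))⁻¹ * F (q.2, q.1.2))
      (((hF.comp m1.measurable).inv).mul (hF.comp m2.measurable))
      (fun g p => α g p.1) (fun g p => (α g p.2)⁻¹) (fun g => by
        filter_upwards [m1.quasiMeasurePreserving.ae (hFc g),
          m2.quasiMeasurePreserving.ae (hFc g)] with q h1 h2
        have e1 := eq_mul_inv_of_mul_eq h1.symm
        have e2 := eq_mul_inv_of_mul_eq h2.symm
        simp only [Prod.smul_mk, Prod.smul_fst, Prod.smul_snd] at e1 e2 ⊢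
        rw [e1, e2]
        group)
    have m3 : MeasurePreserving (fun q : X × (X × X) => ((q.1, q.2.2), q.2.1))
        (μ.prod (μ.prod μ)) ((μ.prod μ).prod μ) :=
      ((measurePreserving_prodAssoc μ μ μ).symm _).comp
        ((MeasurePreserving.id μ).prod Measure.measurePreserving_swap)
    obtain ⟨y, hy⟩ := (Measure.ae_ae_of_ae_prod (m3.quasiMeasurePreserving.ae hFθ)).exists
    refine ⟨fun x => F (x, y), fun x => θ (y, x), by fun_prop, by fun_prop, ?_⟩
    filter_upwards [hy] with p hp
    exact (inv_mul_eq_iff_eq_mul.1 hp)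
  have hconst : ∀ g : Γ, ∃ r : Λ, ∀ᵐ x ∂μ, (φ (g • x))⁻¹ * α g x * φ x = r := fun g => by
    have key : ∀ᵐ p ∂μ.prod μ, (φ (g • p.1))⁻¹ * α g p.1 * φ p.1 =
        ψ (g • p.2) * α g p.2 * (ψ p.2)⁻¹ := by
      filter_upwards [hFc g, hφψ, (measurePreserving_smul g
        (μ.prod μ)).quasiMeasurePreserving.ae hφψ] with p h1 h2 h3
      rw [h2, h3, Prod.smul_fst, Prod.smul_snd] at h1
      rw [eq_mul_inv_iff_mul_eq, mul_assoc, mul_assoc, inv_mul_eq_iff_eq_mul, h1, mul_assoc]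
    obtain ⟨y, hy⟩ := (Measure.ae_ae_of_ae_prod
      (Measure.measurePreserving_swap.quasiMeasurePreserving.ae key)).exists
    exact ⟨ψ (g • y) * α g y * (ψ y)⁻¹, hy⟩
  choose ρ hρ using hconst
  refine ⟨MonoidHom.mk' ρ fun g k => ?_, φ, hφ, fun g => ?_⟩
  · obtain ⟨x, h1, h2, h3, h4⟩ := ((hρ (g * k)).and ((hρ k).and ((hα.map_mul g k).and
      ((measurePreserving_smul k μ).quasiMeasurePreserving.ae (hρ g))))).exists
    rw [← h1, ← h2, ← h4, h3, mul_smul]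
    group
  · filter_upwards [hρ g] with x hx
    simp only [MonoidHom.mk'_apply, ← hx]
    group

end Splitting

section Interpolation

open Filter Topology

/-- If couplings of `μ` with itself converge to the diagonal coupling, then any measurable function
with countably many values agrees on both coordinates up to a small probability. -/
lemma tendsto_coupling_ne {ι X Λ : Type*} [MeasurableSpace X] [Countable Λ] [MeasurableSpace Λ]
    [DiscreteMeasurableSpace Λ] {l : Filter ι} {μ : Measure X} [IsProbabilityMeasure μ]
    {J : ι → Measure (X × X)} (hfst : ∀ i, (J i).fst = μ) (hsnd : ∀ i, (J i).snd = μ)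
    {S : Set (Set X)} (hS : IsPiSystem S)
    (hgen : MeasurableSpace.generateFrom S = ‹MeasurableSpace X›)
    (hlim : ∀ A ∈ S, ∀ B ∈ S, Tendsto (fun i => (J i).real (A ×ˢ B)) l (𝓝 (μ.real (A ∩ B))))
    {a : X → Λ} (ha : Measurable a) :
    Tendsto (fun i => (J i).real {p | a p.1 ≠ a p.2}) l (𝓝 0) := by
  have hprob : ∀ i, IsProbabilityMeasure (J i) := fun i => ⟨by
    rw [← Set.preimage_univ (f := Prod.fst), ← Measure.fst_apply .univ, hfst]; simp⟩
  have hd : Measurable fun x : X => (x, x) := measurable_id.prodMk measurable_id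
  have hdiag : ∀ {A B : Set X}, MeasurableSet A → MeasurableSet B →
      (μ.map fun x => (x, x)).real (A ×ˢ B) = μ.real (A ∩ B) := fun hA hB => by
    rw [map_measureReal_apply hd (hA.prod hB)]; rfl
  have hSm : ∀ A ∈ S, MeasurableSet A := fun A hA => by
    rw [← hgen]; exact MeasurableSpace.measurableSet_generateFrom hA
  have hm : ∀ b, MeasurableSet (a ⁻¹' {b}) := fun b => ha (.singleton b)
  have hlim' : ∀ b, Tendsto (fun i => (J i).real ((a ⁻¹' {b}) ×ˢ (a ⁻¹' {b}))) l
      (𝓝 (μ.real (a ⁻¹' {b}))) := fun b => by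
    have := tendsto_coupling_of_isPiSystem (J' := μ.map fun x => (x, x)) hfst hsnd
      (by rw [Measure.fst_map_prodMk measurable_id']; exact Measure.map_id)
      (by rw [Measure.snd_map_prodMk measurable_id']; exact Measure.map_id) hS hgen hS hgen
      (fun A hA B hB => by rw [hdiag (hSm A hA) (hSm B hB)]; exact hlim A hA B hB) (hm b) (hm b)
    rwa [hdiag (hm b) (hm b), Set.inter_self] at this
  have hsum : ∀ {W : Type _} [MeasurableSpace W] (ρ : Measure W) [IsFiniteMeasure ρ]
      (s : Λ → Set W), (∀ b, MeasurableSet (s b)) → Pairwise (Function.onFun Disjoint s) →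
      HasSum (fun b => ρ.real (s b)) (ρ.real (⋃ b, s b)) := by
    intro W _ ρ _ s hs hdis
    have h := measure_iUnion (μ := ρ) hdis hs
    have hne : ∑' b, ρ (s b) ≠ ⊤ := by rw [← h]; exact measure_ne_top ρ _
    have := ENNReal.hasSum_toReal hne
    rwa [← ENNReal.tsum_toReal_eq fun b => measure_ne_top ρ _, ← h] at this
  have hμsum := hsum μ (fun b => a ⁻¹' {b}) hm fun b c hbc =>
    Disjoint.preimage _ (Set.disjoint_singleton.2 hbc)
  have hJsum := fun i => hsum (J i) (fun b => (a ⁻¹' {b}) ×ˢ (a ⁻¹' {b}))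
    (fun b => (hm b).prod (hm b)) fun b c hbc =>
      Set.disjoint_prod.2 (Or.inl (Disjoint.preimage _ (Set.disjoint_singleton.2 hbc)))
  have htot : (⋃ b, a ⁻¹' {b}) = Set.univ := by ext; simp
  rw [htot, probReal_univ] at hμsum
  have hcompl : ∀ i, (J i).real {p | a p.1 ≠ a p.2} =
      1 - ∑' b, (J i).real ((a ⁻¹' {b}) ×ˢ (a ⁻¹' {b})) := fun i => by
    rw [(hJsum i).tsum_eq, ← probReal_compl_eq_one_sub
      (MeasurableSet.iUnion fun b => (hm b).prod (hm b))]
    congr 1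
    ext p
    simpa using not_congr eq_comm
  simp only [hcompl]
  rw [← sub_self (1 : ℝ)]
  refine tendsto_const_nhds.sub ?_
  rw [← hμsum.tsum_eq]
  refine tendsto_tsum_of_dominated_convergence (bound := fun b => μ.real (a ⁻¹' {b}))
    hμsum.summable hlim' (Eventually.of_forall fun i b => ?_)
  rw [Real.norm_of_nonneg measureReal_nonneg, ← hfst i, measureReal_def, measureReal_def,
    Measure.fst_apply (hm b)]
  exact ENNReal.toReal_mono (measure_ne_top _ _) (measure_mono fun p hp => hp.1)

variable {I Y T : Type}

open Classical in
/-- The configuration which agrees with the second configuration at the sites whose label lies in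
`D` and with the first one elsewhere. -/
noncomputable def mixConfig (D : Set T) (z : ((I → Y) × (I → Y)) × (I → T)) : I → Y :=
  fun i => if z.2 i ∈ D then z.1.2 i else z.1.1 i

lemma mixConfig_empty (z : ((I → Y) × (I → Y)) × (I → T)) : mixConfig ∅ z = z.1.1 :=
  funext fun i => if_neg (Set.notMem_empty (z.2 i))

lemma mixConfig_univ (z : ((I → Y) × (I → Y)) × (I → T)) : mixConfig Set.univ z = z.1.2 :=
  funext fun i => if_pos (Set.mem_univ (z.2 i))

variable [MeasurableSpace Y] [MeasurableSpace T] {ν : Measure Y} [IsProbabilityMeasure ν]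
  {τ : Measure T} [IsProbabilityMeasure τ]

lemma measurePreserving_mixConfig {D : Set T} (hD : MeasurableSet D) :
    MeasurePreserving (mixConfig (I := I) (Y := Y) D)
      (((Measure.infinitePi fun _ : I => ν).prod (Measure.infinitePi fun _ : I => ν)).prod
        (Measure.infinitePi fun _ : I => τ)) (Measure.infinitePi fun _ : I => ν) := by
  classical
  let c : (Y × Y) × T → Y := fun q => if q.2 ∈ D then q.1.2 else q.1.1
  have hc : Measurable c := Measurable.ite (measurable_snd hD)
    (measurable_snd.comp measurable_fst) (measurable_fst.comp measurable_fst)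
  have hcν : ((ν.prod ν).prod τ).map c = ν := by
    ext A hA
    rw [Measure.map_apply hc hA]
    have e : c ⁻¹' A = (Set.univ ×ˢ A) ×ˢ D ∪ (A ×ˢ Set.univ) ×ˢ Dᶜ := by
      ext q
      by_cases hq : q.2 ∈ D <;> simp [c, hq]
    rw [e, measure_union (Set.disjoint_prod.2 (Or.inr disjoint_compl_right))
      ((hA.prod .univ).prod hD.compl)]
    simp only [Measure.prod_prod, measure_univ, one_mul, mul_one]
    rw [← mul_add, measure_add_measure_compl hD, measure_univ, mul_one]
  have h1 : MeasurePreserving (fun (q : I → (Y × Y) × T) (i : I) => c (q i))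
      (Measure.infinitePi fun _ : I => (ν.prod ν).prod τ) (Measure.infinitePi fun _ : I => ν) := by
    refine ⟨by fun_prop, ?_⟩
    rw [Measure.infinitePi_map_pi (μ := fun _ : I => (ν.prod ν).prod τ) fun _ => hc]
    simp only [hcν]
  exact h1.comp (measurePreserving_pairing.comp
    (measurePreserving_pairing.prod (MeasurePreserving.id _)))

lemma tendsto_mixConfig_ne {ι Λ : Type*} [Countable Λ] [MeasurableSpace Λ]
    [DiscreteMeasurableSpace Λ] {l : Filter ι} {T : ι → Type} [∀ i, MeasurableSpace (T i)]
    {τ : ∀ i, Measure (T i)} [∀ i, IsProbabilityMeasure (τ i)] {D D' : ∀ i, Set (T i)}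
    (hD : ∀ i, MeasurableSet (D i)) (hD' : ∀ i, MeasurableSet (D' i))
    (hlim : Tendsto (fun i => (τ i).real (symmDiff (D i) (D' i))) l (𝓝 0))
    {a : (I → Y) → Λ} (ha : Measurable a) :
    Tendsto (fun i =>
      (((Measure.infinitePi fun _ : I => ν).prod (Measure.infinitePi fun _ : I => ν)).prod
        (Measure.infinitePi fun _ : I => τ i)).real
        {z | a (mixConfig (D i) z) ≠ a (mixConfig (D' i) z)}) l (𝓝 0) := by
  classical
  set μ := Measure.infinitePi fun _ : I => ν with hμ
  set m := fun i => (μ.prod μ).prod (Measure.infinitePi fun _ : I => τ i) with hm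
  have hprob : ∀ i, IsProbabilityMeasure (m i) := fun i => by rw [hm]; infer_instance
  have hF := fun i => measurePreserving_mixConfig (I := I) (ν := ν) (τ := τ i) (hD i)
  have hF' := fun i => measurePreserving_mixConfig (I := I) (ν := ν) (τ := τ i) (hD' i)
  have hFF := fun i => (hF i).measurable.prodMk (hF' i).measurable
  have := tendsto_coupling_ne (l := l) (μ := μ)
    (J := fun i => (m i).map fun z => (mixConfig (D i) z, mixConfig (D' i) z))
    (fun i => by rw [Measure.fst_map_prodMk (hF' i).measurable]; exact (hF i).map_eq)
    (fun i => by rw [Measure.snd_map_prodMk (hF i).measurable]; exact (hF' i).map_eq)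
    (isPiSystem_squareCylinders (fun _ => MeasurableSpace.isPiSystem_measurableSet) (by simp))
    generateFrom_squareCylinders ?_ ha
  · refine this.congr fun i => ?_
    have hne : MeasurableSet {p : (I → Y) × (I → Y) | a p.1 ≠ a p.2} :=
      (measurableSet_eq_fun (ha.comp measurable_fst) (ha.comp measurable_snd)).compl
    rw [map_measureReal_apply (hFF i) hne]
    rfl
  rintro A ⟨s, A, hA, rfl⟩ B ⟨t, B, hB, rfl⟩
  have hA' : MeasurableSet ((s : Set I).pi A) := .pi s.countable_toSet fun i _ => hA i trivial
  have hB' : MeasurableSet ((t : Set I).pi B) := .pi t.countable_toSet fun i _ => hB i trivial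
  rw [tendsto_iff_norm_sub_tendsto_zero]
  refine squeeze_zero (fun _ => norm_nonneg _) (fun i => ?_)
    (by simpa using hlim.const_mul (t.card : ℝ))
  have e1 : μ.real ((s : Set I).pi A ∩ (t : Set I).pi B) =
      (m i).real (mixConfig (D i) ⁻¹' ((s : Set I).pi A ∩ (t : Set I).pi B)) := by
    rw [measureReal_def, measureReal_def, (hF i).measure_preimage (hA'.inter hB').nullMeasurableSet]
  have e2 : ∀ j : I, (m i).real {z | z.2 j ∈ symmDiff (D i) (D' i)} =
      (τ i).real (symmDiff (D i) (D' i)) := fun j => by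
    have : MeasurePreserving (fun z : ((I → Y) × (I → Y)) × (I → T i) => z.2 j) (m i) (τ i) :=
      (measurePreserving_eval_infinitePi (fun _ : I => τ i) j).comp measurePreserving_snd
    rw [measureReal_def, measureReal_def, ← this.measure_preimage
      ((hD i).symmDiff (hD' i)).nullMeasurableSet]
    rfl
  rw [map_measureReal_apply (hFF i) (hA'.prod hB'), e1, Real.norm_eq_abs]
  calc _ ≤ (m i).real (symmDiff ((fun z => (mixConfig (D i) z, mixConfig (D' i) z)) ⁻¹'
          ((s : Set I).pi A ×ˢ (t : Set I).pi B))
          (mixConfig (D i) ⁻¹' ((s : Set I).pi A ∩ (t : Set I).pi B))) :=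
        abs_measureReal_sub_le_measureReal_symmDiff
          ((hFF i) (hA'.prod hB')).nullMeasurableSet
          ((hF i).measurable (hA'.inter hB')).nullMeasurableSet
    _ ≤ (m i).real (⋃ j ∈ t, {z | z.2 j ∈ symmDiff (D i) (D' i)}) := by
        refine measureReal_mono (fun z hz => ?_) (measure_ne_top _ _)
        by_contra hne
        simp only [Set.mem_iUnion, not_exists, Set.mem_ofPred_eq] at hne
        have heq : ∀ j ∈ t, mixConfig (D i) z j = mixConfig (D' i) z j := fun j hj => by
          have := hne j hj
          rw [Set.mem_symmDiff] at this
          by_cases h1 : z.2 j ∈ D i <;> by_cases h2 : z.2 j ∈ D' i <;>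
            simp_all [mixConfig]
        have hiff : mixConfig (D i) z ∈ (t : Set I).pi B ↔ mixConfig (D' i) z ∈ (t : Set I).pi B :=
          forall₂_congr fun j hj => by rw [heq j hj]
        rw [Set.mem_symmDiff] at hz
        simp only [Set.mem_preimage, Set.mem_prod, Set.mem_inter_iff, hiff] at hz
        tauto
    _ ≤ ∑ j ∈ t, (m i).real {z | z.2 j ∈ symmDiff (D i) (D' i)} :=
        measureReal_biUnion_finset_le _ _
    _ = t.card * (τ i).real (symmDiff (D i) (D' i)) := by simp [e2]

end Interpolation

section Superrigidity

open Filter Topology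

attribute [local instance] arrowAction

variable {Γ I Y Λ : Type} [Group Γ] [MulAction Γ I]

lemma mixConfig_smul {T : Type} (D : Set T) (g : Γ) (z : ((I → Y) × (I → Y)) × (I → T)) :
    mixConfig D (g • z) = g • mixConfig D z :=
  rfl

variable [MeasurableSpace Y] {ν : Measure Y} [IsProbabilityMeasure ν] [Group Λ]
  [MeasurableSpace Λ]

lemma IsMeasurableCocycle.comp {X Z : Type} [MeasurableSpace X] [MeasurableSpace Z] [MulAction Γ X]
    [MulAction Γ Z] {μ : Measure X} {m : Measure Z} {α : Γ → X → Λ}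
    (hα : IsMeasurableCocycle μ α) {F : Z → X} (hF : MeasurePreserving F m μ)
    (hsmul : ∀ (g : Γ) z, F (g • z) = g • F z) : IsMeasurableCocycle m fun g z => α g (F z) where
  measurable g := (hα.measurable g).comp hF.measurable
  map_mul g h := by
    filter_upwards [hF.quasiMeasurePreserving.ae (hα.map_mul g h)] with z hz
    rw [hz, hsmul]

/-- The uniform probability measure on `Fin (N + 1)`. -/
noncomputable def uniformFin (N : ℕ) : Measure (Fin (N + 1)) :=
  (PMF.uniformOfFintype (Fin (N + 1))).toMeasure

instance (N : ℕ) : IsProbabilityMeasure (uniformFin N) :=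
  PMF.toMeasure.isProbabilityMeasure _

lemma uniformFin_symmDiff_le (N k : ℕ) :
    (uniformFin N).real (symmDiff {u : Fin (N + 1) | (u : ℕ) < k} {u | (u : ℕ) < k + 1}) ≤
      1 / ((N : ℝ) + 1) := by
  have hsub : symmDiff {u : Fin (N + 1) | (u : ℕ) < k} {u | (u : ℕ) < k + 1} ⊆
      {Fin.ofNat (N + 1) k} := by
    intro u hu
    rw [Set.mem_symmDiff] at hu
    simp only [Set.mem_ofPred_eq] at hu
    have hk : (u : ℕ) = k := by omega
    subst hk
    ext
    simp
  refine (measureReal_mono hsub (measure_ne_top _ _)).trans (le_of_eq ?_)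
  rw [measureReal_def, uniformFin, PMF.toMeasure_apply_singleton _ _ (.singleton _),
    PMF.uniformOfFintype_apply, Fintype.card_fin, ENNReal.toReal_inv, ENNReal.toReal_natCast]
  simp

variable [Countable Λ] [DiscreteMeasurableSpace Λ] [Countable Γ]

lemma HasPropertyT.exists_cohomology_mixConfig (hT : HasPropertyT Γ)
    [(escapeFilter Γ I).NeBot] {α : Γ → (I → Y) → Λ}
    (hα : IsMeasurableCocycle (Measure.infinitePi fun _ : I => ν) α) :
    ∃ (N : ℕ) (f : ((I → Y) × (I → Y)) × (I → Fin (N + 1)) → Λ), Measurable f ∧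
      ∀ g : Γ, ∀ᵐ z ∂((Measure.infinitePi fun _ : I => ν).prod
        (Measure.infinitePi fun _ : I => ν)).prod (Measure.infinitePi fun _ : I => uniformFin N),
        α g z.1.1 * f z = f (g • z) * α g z.1.2 := by
  obtain ⟨F, ε, hε, hclose⟩ := hT.exists_cohomology_of_close Λ
  have hlim := fun g : Γ =>
    tendsto_mixConfig_ne (I := I) (ν := ν) (T := fun p : ℕ × ℕ => Fin (p.1 + 1))
      (τ := fun p => uniformFin p.1) (D := fun p => {u | (u : ℕ) < p.2})
      (D' := fun p => {u | (u : ℕ) < p.2 + 1}) (fun _ => .of_discrete) (fun _ => .of_discrete)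
      (squeeze_zero (fun _ => measureReal_nonneg) (fun p => uniformFin_symmDiff_le p.1 p.2)
        (tendsto_one_div_add_atTop_nhds_zero_nat.comp tendsto_comap)) (hα.measurable g)
  have hev := (eventually_all_finset F).2 fun g _ => (hlim g).eventually_lt_const hε
  obtain ⟨N, hN⟩ := (eventually_comap.1 hev).exists
  refine ⟨N, ?_⟩
  set m := ((Measure.infinitePi fun _ : I => ν).prod (Measure.infinitePi fun _ : I => ν)).prod
    (Measure.infinitePi fun _ : I => uniformFin N)
  have hmix : MixingAlong (escapeFilter Γ I) m :=
    (mixingAlong_infinitePi.prod mixingAlong_infinitePi).prod mixingAlong_infinitePi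
  have hcoc : ∀ k : ℕ, IsMeasurableCocycle m fun g z =>
      α g (mixConfig {u : Fin (N + 1) | (u : ℕ) < k} z) := fun k =>
    hα.comp (measurePreserving_mixConfig .of_discrete) fun g z => mixConfig_smul _ g z
  have hchain : ∀ k : ℕ, ∃ f : ((I → Y) × (I → Y)) × (I → Fin (N + 1)) → Λ, Measurable f ∧
      ∀ g : Γ, ∀ᵐ z ∂m, α g z.1.1 * f z =
        f (g • z) * α g (mixConfig {u : Fin (N + 1) | (u : ℕ) < k} z) := by
    intro k
    induction k with
    | zero =>
      refine ⟨fun _ => 1, measurable_const, fun g => Eventually.of_forall fun z => ?_⟩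
      have : {u : Fin (N + 1) | (u : ℕ) < 0} = ∅ := by ext; simp
      rw [this, mixConfig_empty, mul_one, one_mul]
    | succ k ih =>
      obtain ⟨f, hf, h⟩ := ih
      obtain ⟨f', hf', h'⟩ := hclose _ m hmix.isErgodicAction _ _ (hcoc k) (hcoc (k + 1))
        (hN (N, k) rfl)
      refine ⟨fun z => f z * f' z, hf.mul hf', fun g => ?_⟩
      filter_upwards [h g, h' g] with z h1 h2
      rw [← mul_assoc, h1, mul_assoc, h2, mul_assoc]
  obtain ⟨f, hf, h⟩ := hchain (N + 1)
  have huniv : {u : Fin (N + 1) | (u : ℕ) < N + 1} = Set.univ :=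
    Set.eq_univ_of_forall fun u => u.2
  simp only [huniv, mixConfig_univ] at h
  exact ⟨f, hf, h⟩

/-- Cocycle superrigidity for generalized Bernoulli actions of property (T) groups. -/
theorem HasPropertyT.cocycle_superrigidity_infinitePi (hT : HasPropertyT Γ)
    (hI : ∀ i : I, (MulAction.stabilizer Γ i).index = 0) {α : Γ → (I → Y) → Λ}
    (hα : IsMeasurableCocycle (Measure.infinitePi fun _ : I => ν) α) :
    ∃ (ρ : Γ →* Λ) (φ : (I → Y) → Λ), Measurable φ ∧
      ∀ g : Γ, ∀ᵐ x ∂Measure.infinitePi fun _ : I => ν, α g x = φ (g • x) * ρ g * (φ x)⁻¹ := by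
  have := escapeFilter_neBot hI
  obtain ⟨N, f, hf, h⟩ := hT.exists_cohomology_mixConfig hα
  exact hα.exists_hom_of_cohomology mixingAlong_infinitePi mixingAlong_infinitePi hf h

end Superrigidity

/-- **Popa's Cocycle Superrigidity, special case.**  Let `Γ` be a countable group with
property (T), `Γ₀ ≤ Γ` a subgroup of infinite index, `(X₀,μ₀)` a probability space, and
let `Γ` act on the product space `(X,μ) = (X₀,μ₀)^{Γ/Γ₀}` by the generalized Bernoulli
action `(g·x)_c = x_{g⁻¹c}`.  (The product measure `μ` is characterized by its finite
marginals.)  Then for every countable group `Λ` and every measurable cocycle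
`α : Γ × X → Λ` there are a homomorphism `ρ : Γ → Λ` and a measurable `φ : X → Λ` with
`α(g,x) = φ(g·x)·ρ(g)·φ(x)⁻¹` for every `g` and a.e. `x`. -/
theorem popa_cocycle_superrigidity_special
    (Γ : Type) [Group Γ] [Countable Γ] (hT : HasPropertyT Γ)
    (Γ₀ : Subgroup Γ) (hinf : Γ₀.index = 0)
    (X₀ : Type) [MeasurableSpace X₀] (μ₀ : Measure X₀) [IsProbabilityMeasure μ₀]
    (μ : Measure ((Γ ⧸ Γ₀) → X₀)) [IsProbabilityMeasure μ]
    (hμ : ∀ s : Finset (Γ ⧸ Γ₀),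
      Measure.map (fun x (i : s) => x i) μ = Measure.pi fun _ : s => μ₀)
    (Λ : Type) [Group Λ] [Countable Λ] [MeasurableSpace Λ] [DiscreteMeasurableSpace Λ]
    (α : Γ → ((Γ ⧸ Γ₀) → X₀) → Λ)
    (hαm : ∀ g, Measurable (α g))
    (hαcoc : ∀ g h : Γ, ∀ᵐ x ∂μ,
      α (g * h) x = α g (fun c => x (h⁻¹ • c)) * α h x) :
    ∃ (ρ : Γ →* Λ) (φ : ((Γ ⧸ Γ₀) → X₀) → Λ), Measurable φ ∧
      ∀ g : Γ, ∀ᵐ x ∂μ, α g x = φ (fun c => x (g⁻¹ • c)) * ρ g * (φ x)⁻¹ := by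
  have hproj : IsProjectiveLimit μ fun s : Finset (Γ ⧸ Γ₀) => Measure.pi fun _ : s => μ₀ := hμ
  have hμ' : μ = Measure.infinitePi fun _ : Γ ⧸ Γ₀ => μ₀ :=
    hproj.unique (Measure.isProjectiveLimit_infinitePi fun _ => μ₀)
  subst hμ'
  let _ : MulAction Γ (Γ ⧸ Γ₀ → X₀) := arrowAction
  refine hT.cocycle_superrigidity_infinitePi (fun i => ?_) ⟨hαm, hαcoc⟩
  rw [MulAction.index_stabilizer_of_transitive]
  exact hinf
end

section
/- For t ∈ [0,1] define T_t : [0,1]² → [0,1]² by T_t(x,y) = (x,y) if both x ≤ t and y ≤ t, and T_t(x,y) = (y,x) otherwise. Then: (a) each T_t is an involution (T_t ∘ T_t = id) preserving the Lebesgue probability measure m² on [0,1]²; (b) T₁ = id and T₀ is the flip (x,y) ↦ (y,x); (c) the path t ↦ T_t is continuous in the weak topology, i.e. for every Borel set E ⊆ [0,1]² and every s ∈ [0,1], m²(T_t⁻¹(E) Δ T_s⁻¹(E)) → 0 as t → s. Consequently the flip lies in the path-connected component of the identity of the group of measure-preserving transformations of ([0,1]², m²) with the weak topology. -/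
open MeasureTheory Set

/-- The interpolating transformation `T_t` of the unit square: it fixes points with
both coordinates `≤ t` and swaps the two coordinates otherwise. -/
noncomputable def Tpath (t : ℝ) (p : ℝ × ℝ) : ℝ × ℝ :=
  if p.1 ≤ t ∧ p.2 ≤ t then p else p.swap

/-- Two-dimensional Lebesgue measure restricted to the unit square `[0,1]²`. -/
noncomputable def sqMeasure : Measure (ℝ × ℝ) :=
  (volume : Measure (ℝ × ℝ)).restrict ((Icc (0:ℝ) 1) ×ˢ (Icc (0:ℝ) 1))

theorem Tpath_involutive (t : ℝ) : Function.Involutive (Tpath t) := by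
  intro p
  by_cases h : p.1 ≤ t ∧ p.2 ≤ t
  · simp [Tpath, h]
  · have h' : ¬(p.2 ≤ t ∧ p.1 ≤ t) := fun hp => h hp.symm
    simp [Tpath, h, h']

theorem measurable_Tpath (t : ℝ) : Measurable (Tpath t) :=
  Measurable.ite ((measurableSet_le measurable_fst measurable_const).inter
    (measurableSet_le measurable_snd measurable_const)) measurable_id measurable_swap

theorem measurePreserving_Tpath_volume (t : ℝ) :
    MeasurePreserving (Tpath t) (volume : Measure (ℝ × ℝ)) volume := by
  refine ⟨measurable_Tpath t, Measure.ext fun E hE => ?_⟩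
  rw [Measure.map_apply (measurable_Tpath t) hE]
  have hQ : MeasurableSet (Iic t ×ˢ Iic t) := measurableSet_Iic.prod measurableSet_Iic
  have hin : Tpath t ⁻¹' E ∩ Iic t ×ˢ Iic t = E ∩ Iic t ×ˢ Iic t := by
    ext p
    simp only [mem_inter_iff, mem_preimage, mem_prod, mem_Iic]
    refine and_congr_left fun h => ?_
    rw [Tpath, if_pos h]
  have hout : Tpath t ⁻¹' E \ Iic t ×ˢ Iic t = Prod.swap ⁻¹' (E \ Iic t ×ˢ Iic t) := by
    ext p
    simp only [mem_sdiff, mem_preimage, mem_prod, mem_Iic, Prod.fst_swap, Prod.snd_swap]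
    rw [and_comm (a := p.2 ≤ t)]
    refine and_congr_left fun h => ?_
    rw [Tpath, if_neg h]
  have hswap : MeasurePreserving Prod.swap (volume : Measure (ℝ × ℝ)) volume :=
    Measure.measurePreserving_swap
  rw [← measure_inter_add_sdiff (Tpath t ⁻¹' E) hQ, hin, hout,
    hswap.measure_preimage (hE.diff hQ).nullMeasurableSet, measure_inter_add_sdiff E hQ]

theorem Tpath_preimage_prod_self (t : ℝ) (A : Set ℝ) : Tpath t ⁻¹' (A ×ˢ A) = A ×ˢ A := by
  ext p
  by_cases h : p.1 ≤ t ∧ p.2 ≤ t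
  · simp [Tpath, h]
  · simp [Tpath, h, and_comm]

theorem measurePreserving_Tpath (t : ℝ) :
    MeasurePreserving (Tpath t) sqMeasure sqMeasure := by
  have h := (measurePreserving_Tpath_volume t).restrict_preimage
    ((measurableSet_Icc (a := (0:ℝ)) (b := 1)).prod (measurableSet_Icc (a := (0:ℝ)) (b := 1)))
  rwa [Tpath_preimage_prod_self] at h

theorem symmDiff_Tpath_preimage_subset (s t : ℝ) (E : Set (ℝ × ℝ)) :
    symmDiff (Tpath t ⁻¹' E) (Tpath s ⁻¹' E) ⊆ uIcc s t ×ˢ univ ∪ univ ×ˢ uIcc s t := by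
  intro p hp
  by_contra hn
  simp only [mem_union, mem_prod, mem_univ, and_true, true_and, mem_uIcc, not_or, not_and,
    not_le] at hn
  have heq : Tpath t p = Tpath s p := by
    have : (p.1 ≤ t ∧ p.2 ≤ t) ↔ (p.1 ≤ s ∧ p.2 ≤ s) := by grind
    simp only [Tpath, this]
  simp [mem_symmDiff, heq] at hp

theorem sqMeasure_symmDiff_Tpath_preimage_le (s t : ℝ) (E : Set (ℝ × ℝ)) :
    sqMeasure (symmDiff (Tpath t ⁻¹' E) (Tpath s ⁻¹' E)) ≤ 2 * ENNReal.ofReal |t - s| := by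
  have h1 : sqMeasure (uIcc s t ×ˢ univ) ≤ ENNReal.ofReal |t - s| := by
    rw [sqMeasure, Measure.volume_eq_prod, ← Measure.prod_restrict, Measure.prod_prod]
    calc _ ≤ volume (uIcc s t) * 1 := by
          gcongr
          · exact Measure.restrict_le_self
          · simp
      _ = _ := by simp
  have h2 : sqMeasure (univ ×ˢ uIcc s t) ≤ ENNReal.ofReal |t - s| := by
    rw [sqMeasure, Measure.volume_eq_prod, ← Measure.prod_restrict, Measure.prod_prod]
    calc _ ≤ 1 * volume (uIcc s t) := by
          gcongr
          · simp
          · exact Measure.restrict_le_self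
      _ = _ := by simp
  calc _ ≤ sqMeasure (uIcc s t ×ˢ univ ∪ univ ×ˢ uIcc s t) :=
        measure_mono (symmDiff_Tpath_preimage_subset s t E)
    _ ≤ _ := measure_union_le _ _
    _ ≤ _ := add_le_add h1 h2
    _ = _ := (two_mul _).symm


/-- The path `t ↦ T_t` consists of measure-preserving involutions of `([0,1]²,m²)`,
joins the identity (`t = 1`) to the coordinate flip (`t = 0`), and is continuous in the
weak topology; consequently the flip lies in the path-connected component of the
identity of the group of measure-preserving transformations of `([0,1]²,m²)` with
the weak topology. -/
theorem flip_in_weak_path_component_of_id :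
    (∀ t ∈ Icc (0:ℝ) 1, Tpath t ∘ Tpath t = id) ∧
    (∀ t ∈ Icc (0:ℝ) 1, MeasurePreserving (Tpath t) sqMeasure sqMeasure) ∧
    (∀ p ∈ (Icc (0:ℝ) 1) ×ˢ (Icc (0:ℝ) 1), Tpath 1 p = p) ∧
    (∀ p ∈ (Icc (0:ℝ) 1) ×ˢ (Icc (0:ℝ) 1), Tpath 0 p = p.swap) ∧
    (∀ E : Set (ℝ × ℝ), MeasurableSet E → ∀ s ∈ Icc (0:ℝ) 1,
      Filter.Tendsto (fun t => sqMeasure (symmDiff (Tpath t ⁻¹' E) (Tpath s ⁻¹' E)))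
        (nhdsWithin s (Icc (0:ℝ) 1)) (nhds 0)) := by
  refine ⟨fun t _ => (Tpath_involutive t).comp_self, fun t _ => measurePreserving_Tpath t,
    fun p hp => if_pos ⟨hp.1.2, hp.2.2⟩, fun p hp => ?_, fun E _ s _ => ?_⟩
  · unfold Tpath
    split_ifs with h
    · have h1 : p.1 = 0 := le_antisymm h.1 hp.1.1
      have h2 : p.2 = 0 := le_antisymm h.2 hp.2.1
      exact Prod.ext (h1.trans h2.symm) (h2.trans h1.symm)
    · rfl
  · have hlim : Filter.Tendsto (fun t : ℝ => 2 * ENNReal.ofReal |t - s|) (nhds s) (nhds 0) := by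
      have hc : Continuous fun t : ℝ => 2 * ENNReal.ofReal |t - s| :=
        (ENNReal.continuous_const_mul (by simp)).comp
          (ENNReal.continuous_ofReal.comp (by fun_prop))
      simpa using hc.tendsto s
    exact tendsto_of_tendsto_of_tendsto_of_le_of_le tendsto_const_nhds
      (hlim.mono_left nhdsWithin_le_nhds) (fun _ => zero_le)
      (fun t => sqMeasure_symmDiff_Tpath_preimage_le s t E)
end

section
/- Let Γ be a countable group with an ergodic measure-preserving action on a standard probability space (X,μ) which is G_dsc-cocycle-superrigid. Let Λ be a countable group with an ergodic, essentially free, measure-preserving action on a standard σ-finite measure space (Y,ν) (ν(Y) possibly infinite). Let θ : X′ → Y′ be a weak morphism from the orbit relation R_{X,Γ} to the orbit relation R_{Y,Λ}. Then there exist: (1) a group homomorphism ρ : Γ → Λ; (2) a measurable subset Y₁ ⊆ Y with 0 < ν(Y₁) < ∞ which is invariant under Γ₁ = ρ(Γ) and such that the probability measure preserving action of Γ₁ on (Y₁, ν₁), where ν₁ = ν|_{Y₁}/ν(Y₁), is ergodic; and (3) a measurable map T : X → Y₁ with T_*μ = ν₁ and T(g·x) = ρ(g)·T(x) for μ-a.e.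 x ∈ X, for every g ∈ Γ. -/
open MeasureTheory

open Filter Set

/-- A countable family of measurable sets admits a measurable choice of an index. -/
theorem exists_measurable_index {α ι : Type*} [MeasurableSpace α] [Countable ι] [Nonempty ι]
    [MeasurableSpace ι] {P : ι → Set α} (hP : ∀ i, MeasurableSet (P i)) :
    ∃ s : α → ι, Measurable s ∧ ∀ x, (∃ i, x ∈ P i) → x ∈ P (s x) := by
  classical
  obtain ⟨e, he⟩ := exists_surjective_nat ι
  let p : α → ℕ → Prop := fun x n => x ∈ P (e n) ∨ ∀ i, x ∉ P i
  have hp : ∀ x, ∃ n, p x n := by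
    intro x
    by_cases h : ∃ i, x ∈ P i
    · obtain ⟨i, hi⟩ := h
      obtain ⟨n, rfl⟩ := he i
      exact ⟨n, Or.inl hi⟩
    · exact ⟨0, Or.inr (not_exists.1 h)⟩
  have hnone : MeasurableSet {x | ∀ i, x ∉ P i} := by
    have : {x | ∀ i, x ∉ P i} = ⋂ i, (P i)ᶜ := by ext; simp
    rw [this]
    exact MeasurableSet.iInter fun i => (hP i).compl
  have hm : ∀ n, MeasurableSet {x | p x n} := fun n => (hP (e n)).union hnone
  refine ⟨fun x => e (Nat.find (hp x)),
    (measurable_of_countable e).comp (measurable_find hp hm), ?_⟩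
  rintro x ⟨i, hi⟩
  exact (Nat.find_spec (hp x)).resolve_right fun h => h i hi

/-- Acting by a measurable group-valued function is measurable for countable groups. -/
theorem Measurable.smul_of_countable {α G β : Type*} [MeasurableSpace α] [MeasurableSpace β]
    [SMul G β] [Countable G] [MeasurableSpace G] [MeasurableSingletonClass G]
    (h : ∀ g : G, Measurable fun y : β => g • y) {s : α → G} {f : α → β}
    (hs : Measurable s) (hf : Measurable f) : Measurable fun x => s x • f x :=
  (measurable_from_prod_countable_left (f := fun p : β × G => p.2 • p.1) h).comp (hf.prodMk hs)

/-- An almost invariant set agrees almost everywhere with a strictly invariant one. -/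
theorem exists_invariant_ae_eq {G L β : Type*} [Group G] [Countable G] [Group L] [MulAction L β]
    [MeasurableSpace β] {ν : Measure β} (ρ : G →* L)
    (hm : ∀ g, Measurable fun y : β => ρ g • y) {E : Set β} (hE : MeasurableSet E)
    (hinv : ∀ g, (fun y : β => ρ g • y) ⁻¹' E =ᵐ[ν] E) :
    ∃ F ⊆ E, MeasurableSet F ∧ F =ᵐ[ν] E ∧ ∀ g, (fun y : β => ρ g • y) ⁻¹' F = F := by
  refine ⟨⋂ g, (fun y : β => ρ g • y) ⁻¹' E, ?_, MeasurableSet.iInter fun g => hm g hE, ?_, ?_⟩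
  · exact (iInter_subset _ 1).trans (by simp)
  · have h := Filter.EventuallyEq.countable_iInter hinv
    rwa [iInter_const] at h
  · intro g
    ext y
    simp only [mem_preimage, mem_iInter, smul_smul, ← map_mul]
    exact ⟨fun h k => by simpa using h (k * g⁻¹), fun h k => h (k * g)⟩

/-- For an ergodic action, almost invariant sets are null or conull. -/
theorem ae_mem_or_ae_notMem_of_ae_invariant {G α : Type*} [Group G] [Countable G] [MulAction G α]
    [MeasurableSpace α] {μ : Measure α} (hm : ∀ g : G, Measurable fun x : α => g • x)
    (herg : ∀ E : Set α, MeasurableSet E →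
      (∀ g : G, (fun x : α => g • x) ⁻¹' E = E) → μ E = 0 ∨ μ Eᶜ = 0)
    {E : Set α} (hE : MeasurableSet E) (hinv : ∀ g : G, (fun x : α => g • x) ⁻¹' E =ᵐ[μ] E) :
    (∀ᵐ x ∂μ, x ∈ E) ∨ ∀ᵐ x ∂μ, x ∉ E := by
  obtain ⟨F, -, hFm, hFE, hF⟩ := exists_invariant_ae_eq (MonoidHom.id G) hm hE hinv
  rcases herg F hFm hF with h | h
  · exact Or.inr (measure_eq_zero_iff_ae_notMem.1 ((measure_congr hFE).symm.trans h))
  · left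
    filter_upwards [mem_ae_iff.2 h, hFE.mem_iff] with x hx hxE using hxE.1 hx

/-- A probability measure `η ≪ ν` that is invariant and ergodic under a countable group of
measure-preserving transformations of a `σ`-finite measure `ν` is the normalized restriction of `ν`
to an invariant set. Ergodicity is expressed through an equivariant map from an ergodic action. -/
theorem exists_map_eq_smul_restrict {G L α β : Type*} [Group G] [Countable G] [MulAction G α]
    [MeasurableSpace α] {μ : Measure α} [IsProbabilityMeasure μ]
    (hμ : ∀ g : G, MeasurePreserving (fun x : α => g • x) μ μ)
    (herg : ∀ E : Set α, MeasurableSet E →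
      (∀ g : G, (fun x : α => g • x) ⁻¹' E = E) → μ E = 0 ∨ μ Eᶜ = 0)
    [Group L] [MulAction L β] [MeasurableSpace β] {ν : Measure β} [SigmaFinite ν] (ρ : G →* L)
    (hν : ∀ l : L, MeasurePreserving (fun y : β => l • y) ν ν)
    {T : α → β} (hT : Measurable T) (hac : μ.map T ≪ ν)
    (heq : ∀ g : G, ∀ᵐ x ∂μ, T (g • x) = ρ g • T x) :
    ∃ B : Set β, MeasurableSet B ∧ 0 < ν B ∧ ν B < ⊤ ∧
      (∀ g : G, (fun y : β => ρ g • y) ⁻¹' B = B) ∧ μ.map T = (ν B)⁻¹ • ν.restrict B := by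
  have : IsProbabilityMeasure (μ.map T) := Measure.isProbabilityMeasure_map hT.aemeasurable
  set f := (μ.map T).rnDeriv ν with hf
  have hfm : Measurable f := Measure.measurable_rnDeriv _ _
  have hd : ν.withDensity f = μ.map T := Measure.withDensity_rnDeriv_eq _ _ hac
  have hηinv : ∀ g : G, (μ.map T).map (fun y => ρ g • y) = μ.map T := by
    intro g
    calc (μ.map T).map (fun y => ρ g • y) = μ.map (fun x => ρ g • T x) :=
          Measure.map_map (hν (ρ g)).measurable hT
      _ = μ.map (fun x => T (g • x)) :=
          Measure.map_congr ((heq g).mono fun x hx => hx.symm)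
      _ = (μ.map fun x => g • x).map T := (Measure.map_map hT (hμ g).measurable).symm
      _ = μ.map T := by rw [(hμ g).map_eq]
  have hfinv : ∀ g : G, (fun y => f (ρ g • y)) =ᵐ[ν] f := by
    intro g
    refine (withDensity_eq_iff_of_sigmaFinite
      (hfm.comp (hν (ρ g)).measurable).aemeasurable hfm.aemeasurable).1 ?_
    ext s hs
    have hs' := (hν (ρ g⁻¹)).measurable hs
    have hpre : (fun y : β => ρ g • y) ⁻¹' ((fun y : β => ρ g⁻¹ • y) ⁻¹' s) = s := by
      ext y; simp
    calc ν.withDensity (fun y => f (ρ g • y)) s = ∫⁻ y in s, f (ρ g • y) ∂ν :=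
          withDensity_apply _ hs
      _ = ∫⁻ y in (fun y : β => ρ g⁻¹ • y) ⁻¹' s, f y ∂ν := by
          rw [← (hν (ρ g)).setLIntegral_comp_preimage hs' hfm, hpre]
      _ = (μ.map T).map (fun y => ρ g⁻¹ • y) s := by
          rw [← withDensity_apply _ hs', hd, Measure.map_apply (hν _).measurable hs]
      _ = ν.withDensity f s := by rw [hηinv, hd]
  have hfT : ∀ g : G, ∀ᵐ x ∂μ, f (T (g • x)) = f (T x) := by
    intro g
    filter_upwards [heq g, ae_of_ae_map hT.aemeasurable (hac.ae_le (hfinv g))] with x h₁ h₂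
    rw [h₁]
    exact h₂
  obtain ⟨c, hc⟩ : ∃ c, (fun x => f (T x)) =ᵐ[μ] Function.const α c := by
    refine exists_eventuallyEq_const_of_forall_separating MeasurableSet fun U hU => ?_
    refine ae_mem_or_ae_notMem_of_ae_invariant (E := (fun x => f (T x)) ⁻¹' U)
      (fun g => (hμ g).measurable) herg (hfm.comp hT hU) fun g => ?_
    refine eventuallyEq_set.2 ?_
    filter_upwards [hfT g] with x hx
    simp only [mem_preimage, hx]
  have hB₀ : MeasurableSet (f ⁻¹' {c}) := hfm (measurableSet_singleton c)
  have hη : μ.map T = c • ν.restrict (f ⁻¹' {c}) := by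
    have h₁ : (μ.map T).restrict (f ⁻¹' {c}) = μ.map T :=
      Measure.restrict_eq_self_of_ae_mem ((ae_map_iff hT.aemeasurable hB₀).2 hc)
    rw [← h₁, ← hd, restrict_withDensity hB₀, ← withDensity_const]
    exact withDensity_congr_ae (ae_restrict_of_forall_mem hB₀ fun y hy => hy)
  obtain ⟨B, -, hBm, hBae, hBinv⟩ := exists_invariant_ae_eq (ν := ν) ρ
    (fun g => (hν (ρ g)).measurable) hB₀ fun g => by
      refine eventuallyEq_set.2 ?_
      filter_upwards [hfinv g] with y hy
      simp only [mem_preimage, hy]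
  rw [← Measure.restrict_congr_set hBae] at hη
  have hone : c * ν B = 1 := by
    have h := congrArg (fun m : Measure β => m univ) hη
    simpa using h.symm
  have hBc : c = (ν B)⁻¹ := ENNReal.eq_inv_of_mul_eq_one_left hone
  have hB0 : ν B ≠ 0 := fun h => by simp [h] at hone
  have hBtop : ν B ≠ ⊤ := fun h => by simp [hBc, h] at hone
  exact ⟨B, hBm, pos_iff_ne_zero.2 hB0, hBtop.lt_top, hBinv, hBc ▸ hη⟩

/-- A weak morphism of orbit relations out of an ergodic action extends to a morphism defined
almost everywhere. -/
theorem exists_extend_weak_morphism {G L α β : Type*} [Group G] [Countable G] [MulAction G α]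
    [MeasurableSpace α] {μ : Measure α}
    (hμ : ∀ g : G, MeasurePreserving (fun x : α => g • x) μ μ)
    (herg : ∀ E : Set α, MeasurableSet E →
      (∀ g : G, (fun x : α => g • x) ⁻¹' E = E) → μ E = 0 ∨ μ Eᶜ = 0)
    [SMul L β] [MeasurableSpace β] {ν : Measure β}
    {A : Set α} (hA : MeasurableSet A) (hApos : 0 < μ A)
    {θ : α → β} (hθ : Measurable θ) (hac : (μ.restrict A).map θ ≪ ν)
    (horb : ∀ g : G, ∀ᵐ x ∂μ, x ∈ A → g • x ∈ A → ∃ l : L, θ (g • x) = l • θ x) :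
    ∃ ψ : α → β, Measurable ψ ∧ μ.map ψ ≪ ν ∧
      ∀ g : G, ∀ᵐ x ∂μ, ∃ l : L, ψ (g • x) = l • ψ x := by
  have hAg : ∀ g : G, MeasurableSet {x : α | g • x ∈ A} := fun g => (hμ g).measurable hA
  have hcover : ∀ᵐ x ∂μ, ∃ g : G, g • x ∈ A := by
    have hS : {x : α | ∃ g : G, g • x ∈ A} = ⋃ g : G, {x | g • x ∈ A} := by ext; simp
    have hSm : MeasurableSet {x : α | ∃ g : G, g • x ∈ A} :=
      hS ▸ MeasurableSet.iUnion hAg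
    refine mem_ae_iff.2 ((herg _ hSm fun g => ?_).resolve_left fun h => ?_)
    · ext x
      simp only [mem_preimage, mem_ofPred_eq, smul_smul]
      exact ⟨fun ⟨k, hk⟩ => ⟨k * g, hk⟩, fun ⟨k, hk⟩ => ⟨k * g⁻¹, by simpa using hk⟩⟩
    · refine hApos.ne' (measure_mono_null (fun x hx => ?_) h)
      exact ⟨1, by simpa using hx⟩
  let _ : MeasurableSpace G := ⊤
  obtain ⟨s, hs, hsA⟩ := exists_measurable_index hAg
  have hψ : Measurable fun x => θ (s x • x) :=
    hθ.comp (Measurable.smul_of_countable (fun g => (hμ g).measurable) hs measurable_id)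
  refine ⟨fun x => θ (s x • x), hψ, ?_, ?_⟩
  · refine Measure.AbsolutelyContinuous.mk fun E hE hE0 => ?_
    have h₀ := hac hE0
    rw [Measure.map_apply hθ hE, Measure.restrict_apply (hθ hE)] at h₀
    rw [Measure.map_apply hψ hE, measure_eq_zero_iff_ae_notMem]
    have h₁ : ∀ g : G, ∀ᵐ x ∂μ, g • x ∉ θ ⁻¹' E ∩ A := fun g =>
      (hμ g).quasiMeasurePreserving.ae (measure_eq_zero_iff_ae_notMem.1 h₀)
    filter_upwards [ae_all_iff.2 h₁, hcover] with x hx hxA hxE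
    exact hx (s x) ⟨hxE, hsA x hxA⟩
  · intro g
    have h₁ : ∀ᵐ x ∂μ, ∀ h k : G, h • x ∈ A → k • h • x ∈ A →
        ∃ l : L, θ (k • h • x) = l • θ (h • x) :=
      ae_all_iff.2 fun h => ae_all_iff.2 fun k => (hμ h).quasiMeasurePreserving.ae (horb k)
    filter_upwards [h₁, hcover] with x hx hxA
    obtain ⟨k, hk⟩ := hxA
    have hg : s (g • x) • g • x ∈ A := hsA (g • x) ⟨k * g⁻¹, by simpa [smul_smul] using hk⟩
    have he : (s (g • x) * g * (s x)⁻¹) • s x • x = s (g • x) • g • x := by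
      simp [smul_smul]
    have h := hx (s x) (s (g • x) * g * (s x)⁻¹) (hsA x ⟨k, hk⟩)
    rw [he] at h
    exact h hg

/-- A morphism of orbit relations into an essentially free action is given by a cocycle. -/
theorem exists_cocycle_of_orbit_morphism {G L α β : Type*} [Group G] [MulAction G α]
    [MeasurableSpace α] {μ : Measure α}
    (hμ : ∀ g : G, MeasurePreserving (fun x : α => g • x) μ μ)
    [Group L] [Countable L] [MeasurableSpace L] [MulAction L β] [MeasurableSpace β]
    [StandardBorelSpace β] {ν : Measure β}
    (hν : ∀ l : L, Measurable fun y : β => l • y)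
    (hfree : ∀ l : L, l ≠ 1 → ν {y : β | l • y = y} = 0)
    {ψ : α → β} (hψ : Measurable ψ) (hac : μ.map ψ ≪ ν)
    (horb : ∀ g : G, ∀ᵐ x ∂μ, ∃ l : L, ψ (g • x) = l • ψ x) :
    ∃ a : G → α → L, (∀ g, Measurable (a g)) ∧
      (∀ g h : G, ∀ᵐ x ∂μ, a (g * h) x = a g (h • x) * a h x) ∧
      ∀ g : G, ∀ᵐ x ∂μ, ψ (g • x) = a g x • ψ x := by
  have hsel : ∀ g : G, ∃ s : α → L, Measurable s ∧
      ∀ x, (∃ l : L, ψ (g • x) = l • ψ x) → ψ (g • x) = s x • ψ x := fun g =>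
    exists_measurable_index (P := fun l : L => {x : α | ψ (g • x) = l • ψ x}) fun l =>
      measurableSet_eq_fun (hψ.comp (hμ g).measurable) ((hν l).comp hψ)
  choose a ham ha using hsel
  have hae : ∀ g : G, ∀ᵐ x ∂μ, ψ (g • x) = a g x • ψ x := fun g => (horb g).mono (ha g)
  refine ⟨a, ham, fun g h => ?_, hae⟩
  have hfr : ∀ᵐ y ∂ν, ∀ l : L, l • y = y → l = 1 := by
    refine ae_all_iff.2 fun l => ?_
    by_cases hl : l = 1
    · simp [hl]
    · filter_upwards [measure_eq_zero_iff_ae_notMem.1 (hfree l hl)] with y hy h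
      exact absurd h hy
  filter_upwards [hae (g * h), hae h, (hμ h).quasiMeasurePreserving.ae (hae g),
    ae_of_ae_map hψ.aemeasurable (hac.ae_le hfr)] with x h₁ h₂ h₃ h₄
  have h₅ : a (g * h) x • ψ x = (a g (h • x) * a h x) • ψ x := by
    rw [← h₁, mul_smul, h₃, h₂, mul_smul]
  have h₆ := h₄ ((a g (h • x) * a h x)⁻¹ * a (g * h) x) (by
    rw [mul_smul, h₅, inv_smul_smul])
  exact (inv_mul_eq_one.1 h₆).symm

/-- **Superrigidity for orbit relations (main part).**  Let `Γ↷(X,μ)` be an ergodic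
measure-preserving action on a standard probability space which is
`G_dsc`-cocycle-superrigid, let `Λ↷(Y,ν)` be an ergodic, essentially free,
measure-preserving action of a countable group on a standard σ-finite measure space,
and let `θ : X′ → Y′` be a weak morphism of the orbit relations.  Then there are a
homomorphism `ρ : Γ → Λ`, a `ρ(Γ)`-invariant set `Y₁ ⊆ Y` of positive finite measure
on which `ρ(Γ)` acts ergodically, and a measurable `Γ`-equivariant map `T : X → Y₁`
with `T_*μ = ν₁ := ν|_{Y₁}/ν(Y₁)`. -/
theorem superrigidity_for_orbit_relations
    (Γ X : Type) [Group Γ] [Countable Γ]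
    [MeasurableSpace X] [StandardBorelSpace X]
    (μ : Measure X) [IsProbabilityMeasure μ] [MulAction Γ X]
    (hmpX : ∀ g : Γ, MeasurePreserving (fun x : X => g • x) μ μ)
    (hErgX : ∀ E : Set X, MeasurableSet E →
      (∀ g : Γ, (fun x : X => g • x) ⁻¹' E = E) → μ E = 0 ∨ μ Eᶜ = 0)
    -- Γ ↷ (X,μ) is G_dsc-cocycle-superrigid
    (hCSR : ∀ (Λ' : Type) [Group Λ'] [Countable Λ']
      [MeasurableSpace Λ'] [DiscreteMeasurableSpace Λ'],
      ∀ α : Γ → X → Λ', (∀ g, Measurable (α g)) →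
      (∀ g h : Γ, ∀ᵐ x ∂μ, α (g * h) x = α g (h • x) * α h x) →
      ∃ (ρ : Γ →* Λ') (φ : X → Λ'), Measurable φ ∧
        ∀ g : Γ, ∀ᵐ x ∂μ, α g x = φ (g • x) * ρ g * (φ x)⁻¹)
    -- the target action Λ ↷ (Y,ν): ergodic, essentially free, measure preserving
    (Λ Y : Type) [Group Λ] [Countable Λ]
    [MeasurableSpace Y] [StandardBorelSpace Y]
    (ν : Measure Y) [SigmaFinite ν] [MulAction Λ Y]
    (hmpY : ∀ l : Λ, MeasurePreserving (fun y : Y => l • y) ν ν)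
    (hErgY : ∀ E : Set Y, MeasurableSet E →
      (∀ l : Λ, (fun y : Y => l • y) ⁻¹' E = E) → ν E = 0 ∨ ν Eᶜ = 0)
    (hfree : ∀ l : Λ, l ≠ 1 → ν {y : Y | l • y = y} = 0)
    -- the weak morphism θ : X' → Y' of orbit relations
    (X' : Set X) (Y' : Set Y) (hX' : MeasurableSet X') (hY' : MeasurableSet Y')
    (hX'pos : 0 < μ X') (hY'pos : 0 < ν Y')
    (θ : X → Y) (hθm : Measurable θ) (hθmaps : Set.MapsTo θ X' Y')
    (hθac : Measure.map θ (μ.restrict X') ≪ ν.restrict Y')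
    (hθac' : ν.restrict Y' ≪ Measure.map θ (μ.restrict X'))
    (hθorb : ∀ g : Γ, ∀ᵐ x ∂μ, x ∈ X' → g • x ∈ X' →
      ∃ l : Λ, θ (g • x) = l • θ x) :
    ∃ (ρ : Γ →* Λ) (Y₁ : Set Y) (T : X → Y),
      MeasurableSet Y₁ ∧ 0 < ν Y₁ ∧ ν Y₁ < ⊤ ∧
      -- Y₁ is invariant under Γ₁ = ρ(Γ)
      (∀ g : Γ, (fun y : Y => ρ g • y) ⁻¹' Y₁ = Y₁) ∧
      -- the action of Γ₁ on (Y₁, ν₁) is ergodic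
      (∀ E : Set Y, MeasurableSet E → E ⊆ Y₁ →
        (∀ g : Γ, (fun y : Y => ρ g • y) ⁻¹' E = E) →
        ν E = 0 ∨ ν (Y₁ \ E) = 0) ∧
      -- T : X → Y₁ with T_*μ = ν₁ and T(g·x) = ρ(g)·T(x)
      Measurable T ∧ (∀ᵐ x ∂μ, T x ∈ Y₁) ∧
      Measure.map T μ = (ν Y₁)⁻¹ • ν.restrict Y₁ ∧
      (∀ g : Γ, ∀ᵐ x ∂μ, T (g • x) = ρ g • T x) := by
  let _ : MeasurableSpace Λ := ⊤
  have hνm : ∀ l : Λ, Measurable fun y : Y => l • y := fun l => (hmpY l).measurable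
  obtain ⟨ψ, hψ, hψac, hψorb⟩ := exists_extend_weak_morphism (L := Λ) (ν := ν) hmpX hErgX hX'
    hX'pos hθm (hθac.trans Measure.restrict_le_self.absolutelyContinuous) hθorb
  obtain ⟨a, ham, hacoc, haψ⟩ := exists_cocycle_of_orbit_morphism hmpX hνm hfree hψ hψac hψorb
  obtain ⟨ρ, φ, hφ, hρ⟩ := hCSR Λ a ham hacoc
  have hT : Measurable fun x => (φ x)⁻¹ • ψ x :=
    Measurable.smul_of_countable hνm ((measurable_of_countable Inv.inv).comp hφ) hψ
  have hTeq : ∀ g : Γ, ∀ᵐ x ∂μ, (φ (g • x))⁻¹ • ψ (g • x) = ρ g • (φ x)⁻¹ • ψ x := by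
    intro g
    filter_upwards [haψ g, hρ g] with x h₁ h₂
    rw [h₁, h₂]
    simp only [smul_smul]
    group
  have hTac : μ.map (fun x => (φ x)⁻¹ • ψ x) ≪ ν := by
    refine Measure.AbsolutelyContinuous.mk fun E hE hE0 => ?_
    rw [Measure.map_apply hT hE, measure_eq_zero_iff_ae_notMem]
    have h : ∀ᵐ y ∂ν, ∀ l : Λ, l • y ∉ E := ae_all_iff.2 fun l =>
      (hmpY l).quasiMeasurePreserving.ae (measure_eq_zero_iff_ae_notMem.1 hE0)
    filter_upwards [ae_of_ae_map hψ.aemeasurable (hψac.ae_le h)] with x hx using hx _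
  obtain ⟨B, hBm, hB0, hBtop, hBinv, hmap⟩ :=
    exists_map_eq_smul_restrict hmpX hErgX ρ hmpY hT hTac hTeq
  have hnull : ∀ E ⊆ B, MeasurableSet E → μ.map (fun x => (φ x)⁻¹ • ψ x) E = 0 → ν E = 0 := by
    intro E hEB hE h
    rw [hmap, Measure.smul_apply, Measure.restrict_apply hE, inter_eq_left.2 hEB, smul_eq_mul,
      mul_eq_zero, ENNReal.inv_eq_zero] at h
    exact h.resolve_left hBtop.ne
  refine ⟨ρ, B, _, hBm, hB0, hBtop, hBinv, fun E hE hEB hEinv => ?_, hT, ?_, hmap, hTeq⟩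
  · have h := ae_mem_or_ae_notMem_of_ae_invariant (fun g => (hmpX g).measurable) hErgX (hT hE)
      fun g => by
        refine eventuallyEq_set.2 ?_
        filter_upwards [hTeq g] with x hx
        simp only [mem_preimage, hx]
        exact Set.ext_iff.1 (hEinv g) _
    rcases h with h | h
    · right
      refine hnull _ sdiff_subset (hBm.diff hE) ?_
      rw [Measure.map_apply hT (hBm.diff hE), measure_eq_zero_iff_ae_notMem]
      filter_upwards [h] with x hx hx' using hx'.2 hx
    · left
      refine hnull _ hEB hE ?_
      rw [Measure.map_apply hT hE, measure_eq_zero_iff_ae_notMem]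
      exact h
  · refine ae_of_ae_map hT.aemeasurable (p := fun y => y ∈ B) ?_
    rw [hmap]
    exact Measure.ae_smul_measure (ae_restrict_mem hBm) _
end
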